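/- arXiv:1504.04886 — 2 statements merged into one kernel-verified Lean document; each statement's English description precedes it below -/
import Mathlib

section
/- Let n ≥ 1, let m be an ideal of S, and let B = S/m^{[p^n]}, equipped with the Poisson bracket induced from S. Let R be an associative unital W_n(k)-algebra that is flat as a W_n(k)-module, together with a k-algebra isomorphism θ : Z(R/pR) ≅ B such that for all z, w ∈ Z(R/pR) and all lifts z̃, w̃ ∈ R of z, w, there exists c ∈ R with p·c = z̃w̃ − w̃z̃, whose image c mod p lies in Z(R/pR) and satisfies θ(c mod p) = {θ(z), θ(w)}. Then Z(R) = { Σ_{i=1}^n p^{i−1}·x_i^{p^{n−i}} : x_1, …, x_n ∈ R with x_i mod p ∈ Z(R/pR) for all i }, and Z(R) ∩ pR = { Σ_{i=2}^n p^{i−1}·x_i^{p^{n−i}} : x_2, …, x_n ∈ R with x_i mod p ∈ Z(R/pR) for all i }. -/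
universe u

/-- A symplectic Poisson structure on a commutative `k`-algebra `S`: a `k`-bilinear,
antisymmetric bracket which is a derivation in each argument, satisfies the Jacobi identity,
and is nondegenerate in the sense that the `S`-linear map `ι : Ω¹_{S/k} → Der_k(S,S)`
determined by `ι(g·df) = g·{f,·}` is bijective. -/
structure SymplecticPoisson (k S : Type u) [CommRing k] [CommRing S] [Algebra k S] where
  bracket : S → S → S
  add_left : ∀ x y z : S, bracket (x + y) z = bracket x z + bracket y z
  smul_left : ∀ (c : k) (x z : S), bracket (c • x) z = c • bracket x z
  antisymm : ∀ x y : S, bracket x y = - bracket y x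
  leibniz : ∀ x y z : S, bracket x (y * z) = bracket x y * z + y * bracket x z
  jacobi : ∀ x y z : S,
    bracket x (bracket y z) + bracket y (bracket z x) + bracket z (bracket x y) = 0
  nondeg : ∃ ι : KaehlerDifferential k S ≃ₗ[S] Derivation k S S,
    ∀ f g x : S, ι (g • KaehlerDifferential.D k S f) x = g * bracket f x

/-- The ideal generated by the `p ^ e`-th powers of the elements of a set. -/
def frobSpan (p : ℕ) {T : Type*} [CommRing T] (Q : Set T) (e : ℕ) : Ideal T :=
  Ideal.span ((fun f => f ^ p ^ e) '' Q)

section OneDerivation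

variable {p : ℕ} [hp : Fact p.Prime] {T : Type*} [CommRing T] [CharP T p]

variable (T) in
lemma cast_factorial_pred_char : (((p - 1).factorial : ℕ) : T) = -1 := by
  have := congrArg (ZMod.castHom (dvd_refl p) T) (ZMod.wilsons_lemma p)
  rwa [map_natCast, map_neg, map_one] at this

omit hp in
lemma derivation_pow_char (D : Derivation ℤ T T) (x : T) : D (x ^ p) = 0 := by
  simp [Derivation.leibniz_pow]

omit hp [CharP T p] in
lemma derivation_const_mul (D : Derivation ℤ T T) {b : T} (hb : D b = 0) (x : T) :
    D (b * x) = b * D x := by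
  simp [hb]

omit hp [CharP T p] in
lemma derivation_iterate_const_mul (D : Derivation ℤ T T) {b : T} (hb : D b = 0) (n : ℕ) (x : T) :
    D^[n] (b * x) = b * D^[n] x := by
  induction n generalizing x with
  | zero => rfl
  | succ n ih => rw [Function.iterate_succ_apply, derivation_const_mul D hb, ih,
      Function.iterate_succ_apply]

omit hp in
lemma derivation_mem_frobSpan (D : Derivation ℤ T T) {Q : Set T} {e : ℕ} {x : T}
    (hx : x ∈ frobSpan p Q (e + 1)) : D x ∈ frobSpan p Q (e + 1) := by
  rw [frobSpan] at *
  induction hx using Submodule.span_induction with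
  | mem x h =>
    obtain ⟨q, -, rfl⟩ := h
    simp [Derivation.leibniz_pow]
  | zero => simp
  | add x y _ _ hx hy => rw [map_add]; exact add_mem hx hy
  | smul a x h hx =>
    rw [smul_eq_mul, Derivation.leibniz, smul_eq_mul, smul_eq_mul]
    exact add_mem (Ideal.mul_mem_left _ _ hx) (Ideal.mul_mem_right _ _ h)

omit hp in
lemma derivation_iterate_mem_frobSpan (D : Derivation ℤ T T) {Q : Set T} {e : ℕ} (n : ℕ) {x : T}
    (hx : x ∈ frobSpan p Q (e + 1)) : D^[n] x ∈ frobSpan p Q (e + 1) := by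
  induction n generalizing x with
  | zero => exact hx
  | succ n ih => exact ih (derivation_mem_frobSpan D hx)

omit hp [CharP T p] in
lemma derivation_iterate_pow (D : Derivation ℤ T T) {τ : T} (h : D τ = 1) (n m : ℕ) :
    D^[n] (τ ^ m) = (m.descFactorial n : T) * τ ^ (m - n) := by
  induction n with
  | zero => simp
  | succ n ih =>
    rw [Function.iterate_succ_apply', ih, Nat.descFactorial_succ]
    simp [Derivation.leibniz_pow, h, Nat.sub_sub]
    ring

/-- `τ` is a coordinate for `D`: `D τ = 1`, and the ring is generated by `τ` over the constants
of `D`. -/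
structure IsDerivCoord (D : Derivation ℤ T T) (τ : T) : Prop where
  apply_self : D τ = 1
  mem_closure : ∀ x, x ∈ AddSubmonoid.closure {x | ∃ (b : T) (r : ℕ), D b = 0 ∧ x = b * τ ^ r}

variable {D : Derivation ℤ T T} {τ : T}

lemma IsDerivCoord.iterate_char (h : IsDerivCoord D τ) (x : T) : D^[p] x = 0 := by
  induction h.mem_closure x using AddSubmonoid.closure_induction with
  | mem x hx =>
    obtain ⟨b, r, hb, rfl⟩ := hx
    rw [derivation_iterate_const_mul D hb, derivation_iterate_pow D h.apply_self]
    have : ((r.descFactorial p : ℕ) : T) = 0 := by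
      rw [CharP.cast_eq_zero_iff T p]
      exact (Nat.dvd_factorial hp.out.pos le_rfl).trans (Nat.factorial_dvd_descFactorial _ _)
    simp [this]
  | zero => exact iterate_map_zero D p
  | add x y _ _ hx hy => rw [iterate_map_add, hx, hy, add_zero]

omit hp [CharP T p] in
lemma derivation_aeval_pair (D : Derivation ℤ T T) (a b : T) (r : MvPolynomial (Fin 2) ℤ) :
    D (MvPolynomial.aeval ![a, b] r) =
      MvPolynomial.aeval ![a, b] (MvPolynomial.pderiv 0 r) * D a +
      MvPolynomial.aeval ![a, b] (MvPolynomial.pderiv 1 r) * D b := by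
  induction r using MvPolynomial.induction_on with
  | C c => simp
  | add p q hp hq => simp only [map_add, hp, hq]; ring
  | mul_X p i hp =>
    simp only [map_mul, MvPolynomial.aeval_X, Derivation.leibniz, hp, smul_eq_mul, map_add,
      MvPolynomial.pderiv_X]
    fin_cases i <;> simp <;> ring

omit [CharP T p] in
lemma exists_add_pow_mul_derivation (D : Derivation ℤ T T) (a b : T) :
    ∃ G, (a + b) ^ (p - 1) * D (a + b) = a ^ (p - 1) * D a + b ^ (p - 1) * D b + D G := by
  obtain ⟨r, hr⟩ := exists_add_pow_prime_eq hp.out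
    (MvPolynomial.X 0 : MvPolynomial (Fin 2) ℤ) (MvPolynomial.X 1)
  rw [mul_assoc, mul_assoc] at hr
  generalize (MvPolynomial.X 0 * (MvPolynomial.X 1 * r) : MvPolynomial (Fin 2) ℤ) = r at hr
  have hp0 : (p : MvPolynomial (Fin 2) ℤ) ≠ 0 := by exact_mod_cast hp.out.ne_zero
  have h0 := congrArg (MvPolynomial.pderiv 0) hr
  have h1 := congrArg (MvPolynomial.pderiv 1) hr
  simp [Derivation.leibniz_pow, Derivation.leibniz] at h0 h1
  rw [← mul_add] at h0 h1
  have h0 := mul_left_cancel₀ hp0 h0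
  have h1 := mul_left_cancel₀ hp0 h1
  have e0 := congrArg (MvPolynomial.aeval ![a, b]) h0
  have e1 := congrArg (MvPolynomial.aeval ![a, b]) h1
  simp at e0 e1
  refine ⟨MvPolynomial.aeval ![a, b] r, ?_⟩
  rw [derivation_aeval_pair, map_add, mul_add]
  nth_rw 1 [e0]
  rw [e1]
  ring

lemma IsDerivCoord.iterate_pow_mul (h : IsDerivCoord D τ) (s : T) :
    D^[p - 1] (s ^ (p - 1) * D s) = - D s ^ p := by
  have hp1 : p - 1 + 1 = p := Nat.sub_add_cancel hp.out.one_le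
  induction h.mem_closure s using AddSubmonoid.closure_induction with
  | mem x hx =>
    obtain ⟨b, r, hb, rfl⟩ := hx
    rw [derivation_const_mul D hb]
    rcases r with _ | r
    · simp [zero_pow hp.out.ne_zero, iterate_map_zero]
    have e : (b * τ ^ (r + 1)) ^ (p - 1) * (b * D (τ ^ (r + 1))) =
        ((b * τ ^ r) ^ p * (r + 1 : ℕ)) * τ ^ (p - 1) := by
      rw [Derivation.leibniz_pow, h.apply_self]
      have : (b * τ ^ r) ^ p = (b * τ ^ r) ^ (p - 1) * (b * τ ^ r) := by rw [← pow_succ, hp1]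
      rw [this]
      simp only [smul_eq_mul, nsmul_eq_mul, add_tsub_cancel_right, mul_pow, pow_succ]
      ring
    have hc : D ((b * τ ^ r) ^ p * (r + 1 : ℕ)) = 0 := by
      rw [Derivation.leibniz, derivation_pow_char]; simp
    rw [e, derivation_iterate_const_mul D hc, derivation_iterate_pow D h.apply_self,
      Nat.descFactorial_self, Nat.sub_self, pow_zero, mul_one]
    have hw := cast_factorial_pred_char (p := p) T
    have hr : ((r + 1 : ℕ) : T) ^ p = (r + 1 : ℕ) := by
      have := congrArg (ZMod.castHom (dvd_refl p) T) (ZMod.pow_card ((r + 1 : ℕ) : ZMod p))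
      simpa only [map_pow, map_natCast] using this
    rw [hw, Derivation.leibniz_pow, h.apply_self]
    simp only [smul_eq_mul, nsmul_eq_mul, add_tsub_cancel_right, mul_pow, hr]
    ring
  | zero => simp [zero_pow hp.out.ne_zero, iterate_map_zero]
  | add x y _ _ hx hy =>
    obtain ⟨G, hG⟩ := exists_add_pow_mul_derivation (p := p) D x y
    rw [hG, iterate_map_add, iterate_map_add, hx, hy, ← Function.iterate_succ_apply,
      Nat.succ_eq_add_one, hp1, h.iterate_char, map_add, add_pow_char]
    ring

/-- The projection of `⨁ r < p, ker D * τ ^ r` to its degree zero part. -/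
def coordProj (p : ℕ) (D : Derivation ℤ T T) (τ : T) (x : T) : T :=
  - D^[p - 1] (τ ^ (p - 1) * x)

omit hp [CharP T p] in
lemma coordProj_add (x y : T) :
    coordProj p D τ (x + y) = coordProj p D τ x + coordProj p D τ y := by
  simp only [coordProj, mul_add, iterate_map_add]; ring

omit hp [CharP T p] in
lemma coordProj_const_mul {b : T} (hb : D b = 0) (x : T) :
    coordProj p D τ (b * x) = b * coordProj p D τ x := by
  rw [coordProj, mul_left_comm, derivation_iterate_const_mul D hb, coordProj]; ring

lemma coordProj_pow (h : D τ = 1) (r : ℕ) :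
    coordProj p D τ (τ ^ r) = 0 ∨ ∃ q, r = q * p ∧ coordProj p D τ (τ ^ r) = (τ ^ q) ^ p := by
  have hp1 : p - 1 + 1 = p := Nat.sub_add_cancel hp.out.one_le
  have e : τ ^ r = (τ ^ (r / p)) ^ p * τ ^ (r % p) := by
    conv_lhs => rw [← Nat.div_add_mod' r p, pow_add, pow_mul]
  have hw := cast_factorial_pred_char (p := p) T
  rcases hr : r % p with _ | r'
  · right
    refine ⟨r / p, (Nat.div_mul_cancel (Nat.dvd_of_mod_eq_zero hr)).symm, ?_⟩
    rw [e, coordProj_const_mul (derivation_pow_char D _), hr, coordProj, pow_zero, mul_one,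
      derivation_iterate_pow D h, Nat.descFactorial_self, hw]
    simp
  · left
    have hlt : r' + 1 < p := hr ▸ Nat.mod_lt r hp.out.pos
    rw [e, coordProj_const_mul (derivation_pow_char D _), hr, coordProj]
    have : τ ^ (p - 1) * τ ^ (r' + 1) = τ ^ p * τ ^ r' := by
      rw [← pow_add, ← pow_add]; congr 1; omega
    rw [this, derivation_iterate_const_mul D (derivation_pow_char D _),
      derivation_iterate_pow D h, Nat.descFactorial_of_lt (by omega)]
    simp

lemma coordProj_sub_mem (h : D τ = 1) {Q : Set T} {e : ℕ} {x : T}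
    (hx : D x ∈ frobSpan p Q (e + 1)) : coordProj p D τ x - x ∈ frobSpan p Q (e + 1) := by
  have key : ∀ (n : ℕ) (y : T), D^[n] (y * x) - D^[n] y * x ∈ frobSpan p Q (e + 1) := by
    intro n y
    induction n with
    | zero => simp
    | succ n ih =>
      rw [Function.iterate_succ_apply', Function.iterate_succ_apply']
      have h1 := add_mem (derivation_mem_frobSpan D ih) (Ideal.mul_mem_left _ (D^[n] y) hx)
      convert h1 using 1
      simp only [map_sub, Derivation.leibniz, smul_eq_mul]
      ring
  have hw := cast_factorial_pred_char (p := p) T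
  have := key (p - 1) (τ ^ (p - 1))
  rw [derivation_iterate_pow D h, Nat.descFactorial_self, hw] at this
  convert neg_mem this using 1
  simp only [coordProj, Nat.sub_self, pow_zero]
  ring

end OneDerivation

section Coordinates

variable {p : ℕ} [hp : Fact p.Prime] {T : Type*} [CommRing T] [CharP T p]
  {ι : Type*} [Fintype ι] [DecidableEq ι]

/-- Sums of monomials in the `t l` for `l ∈ L` with coefficients that are `p`-th powers. -/
def frobMonomials (p : ℕ) (t : ι → T) (L : Finset ι) : AddSubmonoid T :=
  AddSubmonoid.closure
    {x | ∃ (c : T) (a : ι → ℕ), (∀ l ∉ L, a l = 0) ∧ x = c ^ p * ∏ l, t l ^ a l}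

/-- `t` is a system of coordinates with partial derivatives `D`: these are dual to each other, and
the ring is generated by `t` over its `p`-th powers. -/
structure IsFrobCoords (p : ℕ) (t : ι → T) (D : ι → Derivation ℤ T T) : Prop where
  apply_self : ∀ l, D l (t l) = 1
  apply_of_ne : ∀ l j, j ≠ l → D l (t j) = 0
  mem_univ : ∀ x, x ∈ frobMonomials p t Finset.univ

variable {t : ι → T} {D : ι → Derivation ℤ T T}

omit hp in
lemma IsFrobCoords.apply_erase (h : IsFrobCoords p t D) (l : ι) (c : T) (a : ι → ℕ) :
    D l (c ^ p * ∏ j ∈ Finset.univ.erase l, t j ^ a j) = 0 := by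
  rw [derivation_const_mul _ (derivation_pow_char _ _)]
  have : D l (∏ j ∈ Finset.univ.erase l, t j ^ a j) = 0 := by
    refine Finset.prod_induction _ (fun x => D l x = 0) (fun x y hx hy => by simp [hx, hy])
      (by simp) fun j hj => ?_
    rw [Derivation.leibniz_pow, h.apply_of_ne l j (Finset.ne_of_mem_erase hj)]
    simp
  rw [this, mul_zero]

omit hp [CharP T p] in
lemma pow_mul_prod_eq (p : ℕ) (t : ι → T) (l : ι) (c : T) (a : ι → ℕ) :
    c ^ p * ∏ j, t j ^ a j =
      (c ^ p * ∏ j ∈ Finset.univ.erase l, t j ^ a j) * t l ^ a l := by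
  rw [mul_assoc, Finset.prod_erase_mul _ _ (Finset.mem_univ l)]

omit hp in
lemma IsFrobCoords.isDerivCoord (h : IsFrobCoords p t D) (l : ι) :
    IsDerivCoord (D l) (t l) where
  apply_self := h.apply_self l
  mem_closure x := by
    refine AddSubmonoid.closure_mono ?_ (h.mem_univ x)
    rintro _ ⟨c, a, -, rfl⟩
    exact ⟨_, a l, h.apply_erase l c a, pow_mul_prod_eq p t l c a⟩

lemma IsFrobCoords.coordProj_mem_frobMonomials (h : IsFrobCoords p t D) {L : Finset ι} {l : ι}
    {x : T} (hx : x ∈ frobMonomials p t (insert l L)) :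
    coordProj p (D l) (t l) x ∈ frobMonomials p t L := by
  induction hx using AddSubmonoid.closure_induction with
  | mem x hx =>
    obtain ⟨c, a, ha, rfl⟩ := hx
    rw [pow_mul_prod_eq p t l c a, coordProj_const_mul (h.apply_erase l c a)]
    rcases coordProj_pow (p := p) (h.apply_self l) (a l) with h0 | ⟨q, -, hq⟩
    · rw [h0, mul_zero]
      exact zero_mem _
    · refine AddSubmonoid.subset_closure ⟨c * t l ^ q, Function.update a l 0, fun j hj => ?_, ?_⟩
      · rcases eq_or_ne j l with rfl | hne
        · simp
        · rw [Function.update_of_ne hne]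
          exact ha j (by simp [hne, hj])
      · have : ∏ j ∈ Finset.univ.erase l, t j ^ (Function.update a l 0) j =
            ∏ j ∈ Finset.univ.erase l, t j ^ a j :=
          Finset.prod_congr rfl fun j hj => by
            rw [Function.update_of_ne (Finset.ne_of_mem_erase hj)]
        rw [pow_mul_prod_eq p t l _ (Function.update a l 0), this, hq]
        simp only [Function.update_self, pow_zero, mul_pow]
        ring
  | zero =>
    have := coordProj_const_mul (p := p) (τ := t l) (map_zero (D l)) 0
    rw [zero_mul, zero_mul] at this
    rw [this]
    exact zero_mem _
  | add x y _ _ hx hy => rw [coordProj_add]; exact add_mem hx hy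

omit [DecidableEq ι] in
lemma exists_eq_pow_of_mem_frobMonomials_empty {x : T} (hx : x ∈ frobMonomials p t ∅) :
    ∃ u, x = u ^ p := by
  induction hx using AddSubmonoid.closure_induction with
  | mem x hx =>
    obtain ⟨c, a, ha, rfl⟩ := hx
    exact ⟨c, by simp [ha]⟩
  | zero => exact ⟨0, by simp [hp.out.ne_zero]⟩
  | add x y _ _ hx hy =>
    obtain ⟨u, rfl⟩ := hx
    obtain ⟨v, rfl⟩ := hy
    exact ⟨u + v, (add_pow_char _ _ _).symm⟩

/-- In the presence of coordinates, the subring of `p`-th powers is a direct summand; an element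
whose partial derivatives are small is close to its projection. -/
lemma IsFrobCoords.exists_frob_retraction (h : IsFrobCoords p t D) :
    ∃ π : T → T, (∀ x y, π (x + y) = π x + π y) ∧ (∀ c x, π (c ^ p * x) = c ^ p * π x) ∧
      (∀ x, ∃ u, π x = u ^ p) ∧
      ∀ (Q : Set T) (e : ℕ) (x : T), (∀ l, D l x ∈ frobSpan p Q (e + 1)) →
        π x - x ∈ frobSpan p Q (e + 1) := by
  have key : ∀ L : Finset ι, ∃ π : T → T, (∀ x y, π (x + y) = π x + π y) ∧
      (∀ c x, π (c ^ p * x) = c ^ p * π x) ∧ (∀ x ∈ frobMonomials p t L, ∃ u, π x = u ^ p) ∧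
      ∀ (Q : Set T) (e : ℕ) (x : T), (∀ l, D l x ∈ frobSpan p Q (e + 1)) →
        π x - x ∈ frobSpan p Q (e + 1) := by
    intro L
    induction L using Finset.induction_on with
    | empty =>
      exact ⟨id, fun _ _ => rfl, fun _ _ => rfl,
        fun x hx => exists_eq_pow_of_mem_frobMonomials_empty hx, fun Q e x _ => by simp⟩
    | insert l L _ ih =>
      obtain ⟨π, h1, h2, h3, h4⟩ := ih
      refine ⟨fun x => π (coordProj p (D l) (t l) x), fun x y => ?_, fun c x => ?_, fun x hx => ?_,
        fun Q e x hx => ?_⟩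
      · beta_reduce
        rw [coordProj_add, h1]
      · beta_reduce
        rw [coordProj_const_mul (derivation_pow_char _ _), h2]
      · exact h3 _ (h.coordProj_mem_frobMonomials hx)
      · have hk := coordProj_sub_mem (h.apply_self l) (hx l)
        have := h4 Q e (coordProj p (D l) (t l) x) fun j => by
          have := add_mem (derivation_mem_frobSpan (D j) hk) (hx j)
          rwa [map_sub, sub_add_cancel] at this
        have := add_mem this hk
        rwa [sub_add_sub_cancel] at this
  obtain ⟨π, h1, h2, h3, h4⟩ := key Finset.univ
  exact ⟨π, h1, h2, fun x => h3 x (h.mem_univ x), h4⟩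

lemma IsFrobCoords.mem_frobSpan_of_pow_mem [IsReduced T] (h : IsFrobCoords p t D) {Q : Set T}
    {e : ℕ} {x : T} (hx : x ^ p ∈ frobSpan p Q (e + 1)) : x ∈ frobSpan p Q e := by
  obtain ⟨π, h1, h2, h3, h4⟩ := h.exists_frob_retraction
  have hone : π 1 = 1 := by
    have := h4 ∅ 0 1 (by simp)
    simpa [frobSpan, sub_eq_zero] using this
  have hzero : π 0 = 0 := by simpa using h1 0 0
  have key : ∀ y ∈ frobSpan p Q (e + 1), ∃ z ∈ frobSpan p Q e, π y = z ^ p := by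
    intro y hy
    induction hy using Submodule.closure_induction with
    | zero => exact ⟨0, zero_mem _, by simp [hzero, hp.out.ne_zero]⟩
    | add y y' _ _ hy hy' =>
      obtain ⟨z, hz, e1⟩ := hy
      obtain ⟨z', hz', e2⟩ := hy'
      exact ⟨z + z', add_mem hz hz', by rw [h1, e1, e2, add_pow_char]⟩
    | smul_mem r x hx =>
      obtain ⟨q, hq, rfl⟩ := hx
      obtain ⟨u, hu⟩ := h3 r
      refine ⟨q ^ p ^ e * u, Ideal.mul_mem_right _ _ (Ideal.subset_span ⟨q, hq, rfl⟩), ?_⟩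
      beta_reduce
      rw [smul_eq_mul, mul_comm, pow_succ, pow_mul, h2, hu, mul_pow]
  obtain ⟨z, hz, e1⟩ := key _ hx
  have : π (x ^ p) = x ^ p := by simpa [hone] using h2 x 1
  rw [this] at e1
  have : x = z := by
    have : (x - z) ^ p = 0 := by rw [sub_pow_char, e1, sub_self]
    exact sub_eq_zero.mp (pow_eq_zero_iff hp.out.ne_zero |>.mp this)
  exact this ▸ hz

lemma IsFrobCoords.exists_sub_pow_mem (h : IsFrobCoords p t D) {Q : Set T}
    {e : ℕ} {x : T} (hx : ∀ l, D l x ∈ frobSpan p Q (e + 1)) :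
    ∃ u, x - u ^ p ∈ frobSpan p Q (e + 1) := by
  obtain ⟨π, -, -, h3, h4⟩ := h.exists_frob_retraction
  obtain ⟨u, hu⟩ := h3 x
  refine ⟨u, ?_⟩
  rw [← neg_sub, ← hu]
  exact neg_mem (h4 Q e x hx)

/-- If the Witt-type differential `∑ s i ^ (p ^ (N - i) - 1) * d (s i)` has coefficients in a deep
Frobenius power, then so does `d (s 0)`, with a loss of depth `N`. -/
lemma IsFrobCoords.derivation_mem_of_sum_mem [IsReduced T] (h : IsFrobCoords p t D) {Q : Set T}
    {e : ℕ} (s : ℕ → T) (l : ι) (N : ℕ)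
    (hs : ∑ i ∈ Finset.range (N + 1), s i ^ (p ^ (N - i) - 1) * D l (s i) ∈
      frobSpan p Q (e + 1 + N)) : D l (s 0) ∈ frobSpan p Q (e + 1) := by
  have hp1 : p - 1 + 1 = p := Nat.sub_add_cancel hp.out.one_le
  induction N with
  | zero => simpa using hs
  | succ N ih =>
    apply ih
    apply h.mem_frobSpan_of_pow_mem
    have hmem := neg_mem (derivation_iterate_mem_frobSpan (D l) (p - 1) hs)
    change _ ∈ frobSpan p Q (e + 1 + N + 1) at hmem
    convert hmem using 1
    have hsum : ∀ (M : ℕ) (g : ℕ → T), (D l)^[p - 1] (∑ i ∈ Finset.range M, g i) =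
        ∑ i ∈ Finset.range M, (D l)^[p - 1] (g i) := by
      intro M g
      induction M with
      | zero => simp [iterate_map_zero]
      | succ M ih => rw [Finset.sum_range_succ, iterate_map_add, ih, Finset.sum_range_succ]
    rw [hsum, Finset.sum_range_succ _ (N + 1), Nat.sub_self, pow_zero, Nat.sub_self, pow_zero, one_mul,
      ← Function.iterate_succ_apply, Nat.succ_eq_add_one, hp1, (h.isDerivCoord l).iterate_char,
      add_zero, sum_pow_char, ← Finset.sum_neg_distrib]
    refine Finset.sum_congr rfl fun i hi => ?_
    have hi : i ≤ N := Nat.lt_succ_iff.mp (Finset.mem_range.mp hi)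
    have hexp : p ^ (N + 1 - i) - 1 = (p ^ (N - i) - 1) * p + (p - 1) := by
      have := Nat.one_le_pow (N - i) p hp.out.pos
      rw [Nat.succ_sub hi, pow_succ, Nat.sub_mul, one_mul]
      have : p ≤ p ^ (N - i) * p := Nat.le_mul_of_pos_left p this
      have := hp.out.pos
      omega
    rw [hexp, pow_add, pow_mul, mul_assoc,
      derivation_iterate_const_mul (D l) (derivation_pow_char _ _),
      (h.isDerivCoord l).iterate_pow_mul]
    ring

end Coordinates

section EtaleCoordinates

open scoped TensorProduct

variable {p : ℕ} [hp : Fact p.Prime]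

lemma isEpi_of_formallyUnramified_of_pow_mem {C T : Type*} [CommRing C] [CommRing T]
    [Algebra C T] [CharP T p] [Algebra.FiniteType C T] [Algebra.FormallyUnramified C T]
    (hpow : ∀ x : T, ∃ c : C, algebraMap C T c = x ^ p) : Algebra.IsEpi C T := by
  obtain ⟨e, he, he1⟩ := (Algebra.FormallyUnramified.iff_exists_tensorProduct (R := C) (S := T)).mp
    inferInstance
  have hnil : ∀ z ∈ KaehlerDifferential.ideal C T, IsNilpotent z := by
    intro z hz
    rw [← mem_nilradical]
    revert z
    rw [← SetLike.le_def, ← KaehlerDifferential.span_range_eq_ideal, Ideal.span_le]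
    rintro _ ⟨s, rfl⟩
    rw [SetLike.mem_coe, mem_nilradical]
    refine ⟨p, ?_⟩
    obtain ⟨c, hc⟩ := hpow s
    have hch : (p : T ⊗[C] T) = 0 := by
      have := congrArg (algebraMap T (T ⊗[C] T)) (CharP.cast_eq_zero T p)
      rwa [map_natCast, map_zero] at this
    obtain ⟨r, hr⟩ := exists_add_pow_prime_eq hp.out ((1 : T) ⊗ₜ[C] s - s ⊗ₜ[C] (1 : T))
      (s ⊗ₜ[C] (1 : T))
    rw [hch, zero_mul, zero_mul, zero_mul, add_zero, sub_add_cancel] at hr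
    rw [← add_right_cancel_iff (a := (s ⊗ₜ[C] (1 : T)) ^ p), ← hr, zero_add,
      Algebra.TensorProduct.tmul_pow, Algebra.TensorProduct.tmul_pow, one_pow, ← hc,
      Algebra.algebraMap_eq_smul_one, TensorProduct.tmul_smul, TensorProduct.smul_tmul']
  have hunit : IsUnit e := by
    have h1 : IsNilpotent (1 - e) := hnil _ (by
      rw [KaehlerDifferential.ideal, RingHom.mem_ker]
      simpa [sub_eq_zero] using he1.symm)
    have := h1.isUnit_one_sub
    rwa [sub_sub_cancel] at this
  rw [Algebra.isEpi_iff_forall_one_tmul_eq]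
  intro a
  have := he a
  rw [hunit.mul_left_eq_zero] at this
  exact sub_eq_zero.mp this

variable {k : Type*} [Field k] {d : ℕ}
  {T : Type*} [CommRing T] [CharP T p] [Algebra k T] [Algebra (MvPolynomial (Fin d) k) T]
  [IsScalarTower k (MvPolynomial (Fin d) k) T] [Algebra.Etale (MvPolynomial (Fin d) k) T]

lemma adjoin_pow_char_eq_top (P T : Type*) [CommRing P] [CommRing T] [CharP T p] [Algebra P T]
    [Algebra.FiniteType P T] [Algebra.FormallyUnramified P T] :
    Algebra.adjoin P (Set.range fun x : T => x ^ p) = ⊤ := by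
  set C := Algebra.adjoin P (Set.range fun x : T => x ^ p)
  have hmem : ∀ x : T, x ^ p ∈ C := fun x => Algebra.subset_adjoin ⟨x, rfl⟩
  have : Algebra.FiniteType C T := Algebra.FiniteType.of_restrictScalars_finiteType P C T
  have : Algebra.FormallyUnramified C T := Algebra.FormallyUnramified.of_restrictScalars P C T
  have : Algebra.IsIntegral C T := ⟨fun x => by
    refine IsIntegral.of_pow hp.out.pos ?_
    exact isIntegral_algebraMap (R := C) (x := ⟨x ^ p, hmem x⟩)⟩
  have : Module.Finite C T := Algebra.IsIntegral.finite
  have hepi : Algebra.IsEpi C T :=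
    isEpi_of_formallyUnramified_of_pow_mem fun x => ⟨⟨x ^ p, hmem x⟩, rfl⟩
  have hsurj := Algebra.isEpi_iff_surjective_algebraMap_of_finite.mp hepi
  rw [eq_top_iff]
  intro x _
  obtain ⟨c, rfl⟩ := hsurj x
  exact c.2

lemma isReduced_of_etale_mvPolynomial (k : Type*) [Field k] (d : ℕ) (T : Type*) [CommRing T]
    [Algebra (MvPolynomial (Fin d) k) T] [Algebra.Etale (MvPolynomial (Fin d) k) T] :
    IsReduced T := by
  let P := MvPolynomial (Fin d) k
  let K := FractionRing P
  have : Module.Flat P T := Algebra.Smooth.flat_of_isNoetherianRing P T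
  have : IsReduced (TensorProduct P K T) :=
    Algebra.FormallyUnramified.isReduced_of_field K _
  exact isReduced_of_injective (Algebra.TensorProduct.includeRight : T →ₐ[P] TensorProduct P K T)
    (Algebra.TensorProduct.includeRight_injective (IsFractionRing.injective P K))

lemma mem_frobMonomials_of_etale [PerfectRing k p] (x : T) :
    x ∈ frobMonomials p
      (fun l : Fin d => algebraMap (MvPolynomial (Fin d) k) T (MvPolynomial.X l))
      Finset.univ := by
  set P := MvPolynomial (Fin d) k
  have hx : x ∈ Algebra.adjoin P (Set.range fun x : T => x ^ p) := by
    rw [adjoin_pow_char_eq_top]; trivial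
  have hcl : (Submonoid.closure (Set.range fun x : T => x ^ p) : Set T) =
      Set.range fun x : T => x ^ p := by
    have := Submonoid.closure_eq (MonoidHom.mrange (powMonoidHom p : T →* T))
    exact congrArg SetLike.coe this
  rw [← Subalgebra.mem_toSubmodule, Algebra.adjoin_eq_span, hcl] at hx
  induction hx using Submodule.closure_induction with
  | zero => exact zero_mem _
  | add x y _ _ hx hy => exact add_mem hx hy
  | smul_mem r x hx =>
    obtain ⟨c, rfl⟩ := hx
    induction r using MvPolynomial.induction_on' with
    | monomial a r =>
      obtain ⟨r', hr' : r' ^ p = r⟩ := (PerfectRing.bijective_frobenius (R := k) (p := p)).2 r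
      refine AddSubmonoid.subset_closure ⟨c * algebraMap k T r', a, by simp, ?_⟩
      rw [MvPolynomial.monomial_eq, Algebra.smul_def, map_mul, Finsupp.prod_fintype _ _ (by simp),
        map_prod, mul_pow, ← map_pow, hr', IsScalarTower.algebraMap_apply k P T,
        MvPolynomial.algebraMap_eq]
      simp only [map_pow]
      ring
    | add q q' hq hq' => rw [add_smul]; exact add_mem hq hq'

variable (k p T) in
lemma exists_isFrobCoords_of_etale [PerfectRing k p] :
    ∃ (t : Fin d → T) (D : Fin d → Derivation k T T),
      IsFrobCoords p t (fun l => (D l).restrictScalars ℤ) := by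
  let P := MvPolynomial (Fin d) k
  let b : Module.Basis (Fin d) T (KaehlerDifferential k T) :=
    ((KaehlerDifferential.mvPolynomialBasis k (Fin d)).baseChange T).map
      (KaehlerDifferential.tensorKaehlerEquivOfFormallyEtale k P T)
  have hb : ∀ l, b l = KaehlerDifferential.D k T (algebraMap P T (MvPolynomial.X l)) := by
    intro l
    simp [b, P]
  refine ⟨fun l => algebraMap P T (MvPolynomial.X l),
    fun l => (b.coord l).compDer (KaehlerDifferential.D k T), ⟨fun l => ?_, fun l j hlj => ?_,
      fun x => mem_frobMonomials_of_etale x⟩⟩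
  · change b.coord l (KaehlerDifferential.D k T _) = 1
    rw [← hb]
    simp
  · change b.coord l (KaehlerDifferential.D k T _) = 0
    rw [← hb]
    simp [hlj]

end EtaleCoordinates

section Symplectic

lemma map_frobSpan (p : ℕ) {S T : Type*} [CommRing S] [CommRing T] (f : S →+* T) (Q : Set S)
    (e : ℕ) : (frobSpan p Q e).map f = frobSpan p (f '' Q) e := by
  simp only [frobSpan, Ideal.map_span, Set.image_image, map_pow]

lemma SymplecticPoisson.sum_mul_derivation_mem {k S : Type u} [CommRing k] [CommRing S]
    [Algebra k S] (P : SymplecticPoisson k S) {I : Ideal S} {ι : Type*} (F : Finset ι)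
    (c s : ι → S) (h : ∀ t, ∑ i ∈ F, c i * P.bracket (s i) t ∈ I) (D : Derivation k S S) :
    ∑ i ∈ F, c i * D (s i) ∈ I := by
  obtain ⟨ι', hι'⟩ := P.nondeg
  obtain ⟨η, rfl⟩ := ι'.surjective D
  have hη : η ∈ Submodule.span S (Set.range (KaehlerDifferential.D k S)) := by
    rw [KaehlerDifferential.span_range_derivation]; trivial
  induction hη using Submodule.closure_induction with
  | zero => simp
  | add x y _ _ hx hy =>
    simp only [map_add, Derivation.add_apply, mul_add, Finset.sum_add_distrib]
    exact add_mem hx hy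
  | smul_mem g x hx =>
    obtain ⟨f, rfl⟩ := hx
    have := neg_mem (I.mul_mem_left g (h f))
    rw [Finset.mul_sum, ← Finset.sum_neg_distrib] at this
    convert this using 2 with i
    rw [hι', P.antisymm f]
    ring

lemma sum_mul_derivation_mem_map {k S T : Type*} [CommRing k] [CommRing S] [CommRing T]
    [Algebra k S] [Algebra S T] [Algebra k T] [IsScalarTower k S T]
    [Module.Projective S (KaehlerDifferential k S)] {I : Ideal S} {ι : Type*} (F : Finset ι)
    (c s : ι → S) (h : ∀ D : Derivation k S S, ∑ i ∈ F, c i * D (s i) ∈ I)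
    (Δ : Derivation k T T) :
    ∑ i ∈ F, algebraMap S T (c i) * Δ (algebraMap S T (s i)) ∈ I.map (algebraMap S T) := by
  let φ : KaehlerDifferential k S →ₗ[S] T := (Δ.compAlgebraMap S).liftKaehlerDifferential
  let ω : KaehlerDifferential k S := ∑ i ∈ F, c i • KaehlerDifferential.D k S (s i)
  obtain ⟨σ, hσ⟩ := (Module.projective_def' (R := S) (P := KaehlerDifferential k S)).mp inferInstance
  have hφ : φ ω = ∑ i ∈ F, algebraMap S T (c i) * Δ (algebraMap S T (s i)) := by
    simp [φ, ω, map_sum, Algebra.smul_def]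
  have hω : ω = (σ ω).sum fun q a => a • q := by
    have := congrArg (fun f => f ω) hσ
    exact this.symm
  rw [← hφ, hω, Finsupp.sum, map_sum]
  refine sum_mem fun q _ => ?_
  rw [map_smul, Algebra.smul_def]
  refine Ideal.mul_mem_right _ _ (Ideal.mem_map_of_mem _ ?_)
  have := h (((Finsupp.lapply q).comp σ).compDer (KaehlerDifferential.D k S))
  convert this using 1
  simp [ω, map_sum, Finsupp.finsetSum_apply]

variable {p : ℕ} [hp : Fact p.Prime]

/-- Being a `p`-th power modulo a Frobenius power can be checked on a cover by basic opens. -/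
lemma exists_sub_pow_mem_of_local {S : Type*} [CommRing S] [CharP S p] (I : Ideal S) (s : S)
    (h : ∀ M : Ideal S, M.IsMaximal → ∃ f ∉ M, ∃ u : Localization.Away f,
      algebraMap S (Localization.Away f) s - u ^ p ∈ I.map (algebraMap S _)) :
    ∃ u, s - u ^ p ∈ I := by
  let J : Ideal S :=
    { carrier := {g | ∃ u, g ^ p * s - u ^ p ∈ I}
      zero_mem' := ⟨0, by simp [hp.out.ne_zero]⟩
      add_mem' := by
        rintro g g' ⟨u, hu⟩ ⟨u', hu'⟩
        refine ⟨u + u', ?_⟩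
        rw [add_pow_char, add_pow_char]
        convert add_mem hu hu' using 1
        ring
      smul_mem' := by
        rintro c g ⟨u, hu⟩
        refine ⟨c * u, ?_⟩
        convert I.mul_mem_left (c ^ p) hu using 1
        rw [smul_eq_mul]
        ring }
  by_contra hcon
  have hJ : J ≠ ⊤ := by
    intro hJ
    obtain ⟨u, hu⟩ : (1 : S) ∈ J := hJ ▸ trivial
    exact hcon ⟨u, by simpa using hu⟩
  obtain ⟨M, hM, hJM⟩ := Ideal.exists_le_maximal J hJ
  obtain ⟨f, hf, u, hu⟩ := h M hM
  obtain ⟨a, ⟨_, r, rfl⟩, rfl⟩ := IsLocalization.exists_mk'_eq (Submonoid.powers f) u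
  have key : algebraMap S (Localization.Away f) ((f ^ r) ^ p * s - a ^ p) ∈
      I.map (algebraMap S _) := by
    convert Ideal.mul_mem_left _ (algebraMap S _ ((f ^ r) ^ p)) hu using 1
    rw [mul_sub, map_sub, map_mul, map_pow _ (f ^ r), ← mul_pow]
    congr 2
    rw [map_pow]
    congr 1
    exact (IsLocalization.mk'_spec' _ a (⟨f ^ r, r, rfl⟩ : Submonoid.powers f)).symm
  rw [IsLocalization.algebraMap_mem_map_algebraMap_iff (Submonoid.powers f)] at key
  obtain ⟨_, ⟨r', rfl⟩, hw⟩ := key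
  have : f ^ r' * f ^ r ∈ J := by
    refine ⟨f ^ r' * a, ?_⟩
    convert I.mul_mem_left ((f ^ r') ^ (p - 1)) hw using 1
    have : (f ^ r') ^ p = (f ^ r') ^ (p - 1) * f ^ r' := by
      rw [← pow_succ, Nat.sub_add_cancel hp.out.one_le]
    rw [mul_pow, mul_pow, this]
    ring
  rw [← pow_add] at this
  exact hf (hM.isPrime.mem_of_pow_mem _ (hJM this))

lemma SymplecticPoisson.exists_sub_pow_mem {k S : Type u} [Field k] [CharP k p]
    [PerfectRing k p] [CommRing S] [Algebra k S] [Algebra.FiniteType k S]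
    [Algebra.FormallySmooth k S] (P : SymplecticPoisson k S) (m : Set S) (N e : ℕ) (s : ℕ → S)
    (hs : ∀ t, ∑ i ∈ Finset.range (N + 1), s i ^ (p ^ (N - i) - 1) * P.bracket (s i) t ∈
      frobSpan p m (e + 1 + N)) : ∃ u, s 0 - u ^ p ∈ frobSpan p m (e + 1) := by
  rcases subsingleton_or_nontrivial S with hS | hS
  · exact ⟨0, by rw [Subsingleton.elim (s 0 - 0 ^ p) 0]; exact zero_mem _⟩
  have : CharP S p := charP_of_injective_algebraMap (algebraMap k S).injective p
  have : Algebra.FinitePresentation k S := Algebra.FinitePresentation.of_finiteType.mp ‹_›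
  have : Algebra.Smooth k S := ⟨‹_›, ‹_›⟩
  refine exists_sub_pow_mem_of_local _ _ fun M hM => ?_
  obtain ⟨f, hfM, hf⟩ := Algebra.IsSmoothAt.exists_notMem_isStandardSmooth k M
  refine ⟨f, hfM, ?_⟩
  let T := Localization.Away f
  obtain ⟨d, φ, hφ, het⟩ := RingHom.IsStandardSmooth.exists_etale_mvPolynomial
    (f := algebraMap k T) (by simpa [RingHom.isStandardSmooth_algebraMap])
  algebraize [φ]
  have := IsScalarTower.of_algebraMap_eq' hφ.symm
  have hT : Nontrivial T := by
    by_contra hT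
    rw [not_nontrivial_iff_subsingleton,
      IsLocalization.subsingleton_iff (S := T) (M := Submonoid.powers f)] at hT
    obtain ⟨r, hr⟩ := hT
    exact hfM (hM.isPrime.mem_of_pow_mem r (by rw [show f ^ r = 0 from hr]; exact zero_mem M))
  have : CharP T p := charP_of_injective_algebraMap (algebraMap k T).injective p
  have : IsReduced T := isReduced_of_etale_mvPolynomial k d T
  obtain ⟨t, D, hD⟩ := exists_isFrobCoords_of_etale p k T (d := d)
  rw [map_frobSpan]
  refine hD.exists_sub_pow_mem fun l => ?_
  refine hD.derivation_mem_of_sum_mem (fun i => algebraMap S T (s i)) l N ?_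
  have := sum_mul_derivation_mem_map (T := T) _ _ s (P.sum_mul_derivation_mem _ _ s hs) (D l)
  rw [map_frobSpan] at this
  simp only [map_pow] at this
  exact this

end Symplectic

section TruncatedWittVector

lemma TruncatedWittVector.exists_eq_pow_mul_of_mul_eq_zero {p : ℕ} [Fact p.Prime] {k : Type*}
    [Field k] [CharP k p] [PerfectRing k p] {n : ℕ}
    {a : TruncatedWittVector p n k} (ha : (p : TruncatedWittVector p n k) * a = 0) :
    ∃ b, a = (p : TruncatedWittVector p n k) ^ (n - 1) * b := by
  obtain ⟨x, rfl⟩ := WittVector.truncate_surjective p n k a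
  rw [mul_comm, ← map_natCast (WittVector.truncate (p := p) n), ← map_mul, ← RingHom.mem_ker,
    WittVector.mem_ker_truncate] at ha
  have hx : x ∈ Ideal.span {((p : WittVector p k) ^ (n - 1))} := by
    rw [WittVector.mem_span_p_pow_iff_le_coeff_eq_zero]
    intro i hi
    have := ha (i + 1) (by lia)
    rw [WittVector.mul_charP_coeff_succ] at this
    exact eq_zero_of_pow_eq_zero this
  obtain ⟨y, rfl⟩ := Ideal.mem_span_singleton.mp hx
  exact ⟨WittVector.truncate n y, by simp⟩

lemma TruncatedWittVector.natCast_pow_eq_zero (p : ℕ) [Fact p.Prime] (k : Type*)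
    [CommRing k] [CharP k p] (n : ℕ) : (p : TruncatedWittVector p n k) ^ n = 0 := by
  rw [← map_natCast (WittVector.truncate (p := p) n), ← map_pow, ← RingHom.mem_ker,
    WittVector.mem_ker_truncate]
  intro i hi
  exact WittVector.coeff_p_pow_eq_zero p k hi.ne

lemma Module.Flat.exists_eq_smul_of_smul_eq_zero {A M : Type*} [CommRing A] [AddCommGroup M]
    [Module A M] [Module.Flat A M] {a b : A} (hab : ∀ c, a * c = 0 → ∃ d, c = b * d) {x : M}
    (hx : a • x = 0) : ∃ y, x = b • y := by
  obtain ⟨l, f, y, hy, hf⟩ := Module.Flat.isTrivialRelation_of_sum_smul_eq_zero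
    (ι := Fin 1) (f := fun _ => a) (x := fun _ => x) (by simpa using hx)
  choose g hg using fun j => hab (f 0 j) (by simpa using hf j)
  refine ⟨∑ j, g j • y j, ?_⟩
  rw [show x = _ from hy 0, Finset.smul_sum]
  exact Finset.sum_congr rfl fun j _ => by rw [hg, mul_smul]

end TruncatedWittVector

section Commutator

variable {R R₁ : Type*} [Ring R] [Ring R₁]

lemma pow_mul_sub_mul_pow (x r : R) (q : ℕ) :
    x ^ q * r - r * x ^ q =
      ∑ i ∈ Finset.range q, x ^ i * (x * r - r * x) * x ^ (q - 1 - i) := by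
  induction q with
  | zero => simp
  | succ q ih =>
    have h : x ^ (q + 1) * r - r * x ^ (q + 1) =
        (x ^ q * r - r * x ^ q) * x + x ^ q * (x * r - r * x) := by
      rw [pow_succ]; noncomm_ring
    rw [h, ih, Finset.sum_range_succ, Finset.sum_mul]
    congr 1
    · refine Finset.sum_congr rfl fun i hi => ?_
      rw [mul_assoc, ← pow_succ]
      have := Finset.mem_range.mp hi
      congr 2
      lia
    · simp

lemma mul_natCast_pow_mul (p : ℕ) (b : ℕ) (x y : R) :
    x * ((p : R) ^ b * y) = (p : R) ^ b * (x * y) := by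
  rw [← mul_assoc, ← mul_assoc, ((Nat.cast_commute p x).pow_left b).eq]

lemma pow_mul_sub_mul_pow_of_eq {p b : ℕ} {x r c : R} (q : ℕ)
    (h : x * r - r * x = (p : R) ^ b * c) :
    x ^ q * r - r * x ^ q =
      (p : R) ^ b * ∑ i ∈ Finset.range q, x ^ i * c * x ^ (q - 1 - i) := by
  rw [pow_mul_sub_mul_pow, h, Finset.mul_sum]
  refine Finset.sum_congr rfl fun i _ => ?_
  rw [mul_natCast_pow_mul, mul_assoc]

/-- `ρ : R → R₁` identifies `R₁` with `R / pR`. -/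
structure IsModP (p : ℕ) (ρ : R →+* R₁) : Prop where
  surj : Function.Surjective ρ
  map_eq_zero_iff : ∀ x : R, ρ x = 0 ↔ ∃ y : R, x = (p : R) * y

namespace IsModP

variable {p : ℕ} {ρ : R →+* R₁} (h : IsModP p ρ)
include h

lemma natCast_eq_zero : (p : R₁) = 0 := by
  rw [← map_natCast ρ]
  exact (h.map_eq_zero_iff _).mpr ⟨1, by simp⟩

lemma exists_commutator_eq_of_center {x : R} (hx : ρ x ∈ Subring.center R₁) (r : R) :
    ∃ c, x * r - r * x = (p : R) * c := by
  rw [← h.map_eq_zero_iff, map_sub, map_mul, map_mul, Subring.mem_center_iff.mp hx, sub_self]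

lemma mem_center_of_commutator {x : R} (hx : ∀ r, ∃ c, x * r - r * x = (p : R) * c) :
    ρ x ∈ Subring.center R₁ := by
  rw [Subring.mem_center_iff]
  intro g
  obtain ⟨r, rfl⟩ := h.surj g
  have := (h.map_eq_zero_iff _).mpr (hx r)
  rw [map_sub, map_mul, map_mul, sub_eq_zero] at this
  exact this.symm

lemma exists_commutator_pow_eq {x : R} (hx : ρ x ∈ Subring.center R₁) (r : R) (a : ℕ) :
    ∃ c, x ^ p ^ a * r - r * x ^ p ^ a = (p : R) ^ (a + 1) * c := by
  induction a with
  | zero => simpa using h.exists_commutator_eq_of_center hx r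
  | succ a ih =>
    obtain ⟨c, hc⟩ := ih
    have hy : ρ (x ^ p ^ a) ∈ Subring.center R₁ := by rw [map_pow]; exact pow_mem hx _
    generalize hy' : x ^ p ^ a = y at hc hy
    obtain ⟨c', hc'⟩ : ∃ c', ∑ i ∈ Finset.range p, y ^ i * c * y ^ (p - 1 - i) = (p : R) * c' := by
      rw [← h.map_eq_zero_iff, map_sum]
      have : ∀ i ∈ Finset.range p, ρ (y ^ i * c * y ^ (p - 1 - i)) = ρ c * ρ y ^ (p - 1) := by
        intro i hi
        have := Finset.mem_range.mp hi
        rw [map_mul, map_mul, map_pow, map_pow, ← Subring.mem_center_iff.mp (pow_mem hy i),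
          mul_assoc, ← pow_add]
        congr 2
        lia
      rw [Finset.sum_congr rfl this]
      simp [h.natCast_eq_zero]
    refine ⟨c', ?_⟩
    rw [pow_succ p a, pow_mul, hy', pow_mul_sub_mul_pow_of_eq p hc, hc', ← mul_assoc, ← pow_succ]

lemma exists_commutator_pow_char (hp : 2 < p) (hpp : p.Prime) {x r c e : R} {b : ℕ}
    (hx : ρ x ∈ Subring.center R₁)
    (hc : x * r - r * x = (p : R) ^ b * c) (he : x * c - c * x = (p : R) * e) :
    ∃ c', x ^ p * r - r * x ^ p = (p : R) ^ (b + 1) * c' ∧ ρ c' = ρ x ^ (p - 1) * ρ c := by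
  let E : ℕ → R := fun i => ∑ l ∈ Finset.range i, x ^ l * e * x ^ (i - 1 - l)
  have hE : ∀ i, x ^ i * c = c * x ^ i + (p : R) * E i := fun i => by
    rw [← pow_one (p : R)] at he
    rw [← sub_eq_iff_eq_add', pow_mul_sub_mul_pow_of_eq i he, pow_one]
  have hρE : ∀ i, ρ (E i) = ρ e * ((i : R₁) * ρ x ^ (i - 1)) := fun i => by
    have : ∀ l ∈ Finset.range i, ρ (x ^ l * e * x ^ (i - 1 - l)) = ρ e * ρ x ^ (i - 1) := by
      intro l hl
      have := Finset.mem_range.mp hl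
      rw [map_mul, map_mul, map_pow, map_pow, ← Subring.mem_center_iff.mp (pow_mem hx l),
        mul_assoc, ← pow_add]
      congr 2
      lia
    rw [map_sum, Finset.sum_congr rfl this, Finset.sum_const, Finset.card_range, nsmul_eq_mul,
      ← mul_assoc, ← mul_assoc, (Nat.cast_commute i (ρ e)).eq]
  refine ⟨c * x ^ (p - 1) + ∑ i ∈ Finset.range p, E i * x ^ (p - 1 - i), ?_, ?_⟩
  · rw [pow_mul_sub_mul_pow_of_eq p hc, pow_succ, mul_assoc]
    congr 1
    have : ∀ i ∈ Finset.range p, x ^ i * c * x ^ (p - 1 - i) =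
        c * x ^ (p - 1) + (p : R) * (E i * x ^ (p - 1 - i)) := by
      intro i hi
      have := Finset.mem_range.mp hi
      rw [hE, add_mul, mul_assoc c, ← pow_add, mul_assoc]
      congr 3
      lia
    rw [Finset.sum_congr rfl this, Finset.sum_add_distrib, Finset.sum_const,
      Finset.card_range, nsmul_eq_mul, mul_add, Finset.mul_sum]
  · have h0 : ∑ i ∈ Finset.range p, ρ (E i) * ρ x ^ (p - 1 - i) = 0 := by
      have : ∀ i ∈ Finset.range p, ρ (E i) * ρ x ^ (p - 1 - i) =
          ρ e * ((i : R₁) * ρ x ^ (p - 2)) := by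
        intro i hi
        have := Finset.mem_range.mp hi
        rw [hρE, mul_assoc, mul_assoc]
        rcases Nat.eq_zero_or_pos i with rfl | hi0
        · simp
        · rw [← pow_add]
          congr 3
          lia
      rw [Finset.sum_congr rfl this, ← Finset.mul_sum, ← Finset.sum_mul, ← Nat.cast_sum,
        Finset.sum_range_id, Nat.mul_div_assoc]
      · simp [h.natCast_eq_zero]
      · exact (Nat.Odd.sub_odd (hpp.eq_two_or_odd'.resolve_left hp.ne') odd_one).two_dvd
    rw [map_add, map_sum]
    simp only [map_mul, map_pow]
    rw [h0, add_zero, Subring.mem_center_iff.mp (pow_mem hx _)]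

lemma exists_commutator_pow_eq_of_poisson (hp : 2 < p) (hpp : p.Prime)
    (hbr : ∀ z w : R, ρ z ∈ Subring.center R₁ → ρ w ∈ Subring.center R₁ →
      ∃ c, (p : R) * c = z * w - w * z ∧ ρ c ∈ Subring.center R₁)
    {x r c : R} (hx : ρ x ∈ Subring.center R₁) (hc : ρ c ∈ Subring.center R₁)
    (hxr : x * r - r * x = (p : R) * c) (a : ℕ) :
    ∃ d, x ^ p ^ a * r - r * x ^ p ^ a = (p : R) ^ (a + 1) * d ∧
      ρ d = ρ x ^ (p ^ a - 1) * ρ c := by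
  induction a with
  | zero => exact ⟨c, by simpa using hxr, by simp⟩
  | succ a ih =>
    obtain ⟨d, hd, hρd⟩ := ih
    have hy : ρ (x ^ p ^ a) ∈ Subring.center R₁ := by rw [map_pow]; exact pow_mem hx _
    have hdc : ρ d ∈ Subring.center R₁ := by rw [hρd]; exact mul_mem (pow_mem hx _) hc
    obtain ⟨e, he, -⟩ := hbr _ d hy hdc
    obtain ⟨d', hd', hρd'⟩ := h.exists_commutator_pow_char hp hpp hy hd he.symm
    refine ⟨d', by rw [pow_succ p a, pow_mul, hd'], ?_⟩
    rw [hρd', hρd, map_pow, ← mul_assoc, ← pow_mul, ← pow_add]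
    congr 2
    have h1 : 1 ≤ p ^ a := Nat.one_le_pow _ _ hpp.pos
    rw [pow_succ, Nat.mul_sub, mul_one]
    have := Nat.mul_le_mul_left (p ^ a) hpp.one_le
    lia

variable {n : ℕ}

lemma pow_mul_pow_mem_center (hn : (p : R) ^ n = 0) {x : R} (hx : ρ x ∈ Subring.center R₁)
    {i a : ℕ} (hia : n ≤ i + a + 1) : (p : R) ^ i * x ^ p ^ a ∈ Subring.center R := by
  rw [Subring.mem_center_iff]
  intro g
  obtain ⟨c, hc⟩ := h.exists_commutator_pow_eq hx g a
  have h0 : (p : R) ^ i * (x ^ p ^ a * g - g * x ^ p ^ a) = 0 := by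
    rw [hc, ← mul_assoc, ← pow_add, ← add_assoc, pow_eq_zero_of_le hia hn, zero_mul]
  rw [mul_sub, sub_eq_zero] at h0
  rw [mul_natCast_pow_mul, mul_assoc, h0]

omit h in
/-- The kernel of multiplication by `p ^ j` is contained in `pR` for `j < n`. -/
lemma exists_eq_mul_of_pow_mul_eq
    (htors : ∀ x : R, (p : R) * x = 0 → ∃ y, x = (p : R) ^ (n - 1) * y)
    {j : ℕ} (hj : j < n) {x y : R} (hxy : (p : R) ^ j * x = (p : R) ^ (j + 1) * y) :
    ∃ z, x = (p : R) * z := by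
  have key : ∀ j < n, ∀ x : R, (p : R) ^ j * x = 0 → ∃ z, x = (p : R) * z := by
    intro j
    induction j with
    | zero => exact fun _ x hx => ⟨0, by simpa using hx⟩
    | succ j ih =>
      intro hj x hx
      rw [pow_succ', mul_assoc] at hx
      obtain ⟨w, hw⟩ := htors _ hx
      have h1 : (p : R) ^ (n - 1) = (p : R) ^ j * (p : R) * (p : R) ^ (n - 2 - j) := by
        rw [← pow_succ, ← pow_add]
        congr 1
        lia
      obtain ⟨z, hz⟩ := ih (by lia) (x - (p : R) * (p : R) ^ (n - 2 - j) * w) (by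
        rw [mul_sub, hw, h1]; simp only [mul_assoc]; simp)
      exact ⟨z + (p : R) ^ (n - 2 - j) * w, by rw [mul_add, ← hz]; simp only [mul_assoc]; simp⟩
  obtain ⟨z, hz⟩ := key j hj (x - (p : R) * y) (by rw [mul_sub, hxy, pow_succ, mul_assoc, sub_self])
  exact ⟨z + y, by rw [mul_add, ← hz]; simp⟩

/-- An element all of whose commutators are divisible by `p ^ j` is, modulo `p ^ j`, a sum of
`p ^ i`-multiples of `p ^ (j - 1 - i)`-th powers of elements that are central modulo `p`. -/
lemma exists_eq_sum_of_commutator (hp : 2 < p) (hpp : p.Prime)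
    (htors : ∀ x : R, (p : R) * x = 0 → ∃ y, x = (p : R) ^ (n - 1) * y)
    (hbr : ∀ z w : R, ρ z ∈ Subring.center R₁ → ρ w ∈ Subring.center R₁ →
      ∃ c, (p : R) * c = z * w - w * z ∧ ρ c ∈ Subring.center R₁)
    (hroot : ∀ N, N + 1 < n → ∀ x : ℕ → R, (∀ i, ρ (x i) ∈ Subring.center R₁) →
      (∀ r, ρ r ∈ Subring.center R₁ → ∀ c : ℕ → R, (∀ i, x i * r - r * x i = (p : R) * c i) →
        (∀ i, ρ (c i) ∈ Subring.center R₁) →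
        ∑ i ∈ Finset.range (N + 1), ρ (x i) ^ (p ^ (N - i) - 1) * ρ (c i) = 0) →
      ∃ u, ρ u ∈ Subring.center R₁ ∧ ρ (x 0) ^ p ^ N = ρ u ^ p ^ (N + 1))
    {j : ℕ} (hj : j ≤ n) {y : R} (hy : ∀ r, ∃ c, y * r - r * y = (p : R) ^ j * c) :
    ∃ x : ℕ → R, (∀ i, ρ (x i) ∈ Subring.center R₁) ∧
      ∃ w, y = ∑ i ∈ Finset.range j, (p : R) ^ i * x i ^ p ^ (j - 1 - i) + (p : R) ^ j * w := by
  induction j generalizing y with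
  | zero => exact ⟨0, fun i => by simp [zero_mem], y, by simp⟩
  | succ j ih =>
    obtain ⟨v, hv, hyv⟩ : ∃ v, ρ v ∈ Subring.center R₁ ∧ ρ y = ρ v ^ p ^ j := by
      rcases j with _ | N
      · exact ⟨y, h.mem_center_of_commutator (by simpa using hy), by simp⟩
      · obtain ⟨x, hx, w, hw⟩ := ih (y := y) (by lia) fun r => by
          obtain ⟨c, hc⟩ := hy r
          exact ⟨(p : R) * c, by rw [hc, pow_succ, mul_assoc]⟩
        obtain ⟨u, hu, hxu⟩ := hroot N (by lia) x hx fun r hr c hc hcc => by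
          choose d hd hρd using fun i =>
            h.exists_commutator_pow_eq_of_poisson hp hpp hbr (hx i) (hcc i) (hc i) (N - i)
          obtain ⟨w', hw'⟩ := h.exists_commutator_eq_of_center hr w
          obtain ⟨c', hc'⟩ := hy r
          have hsum : ∀ i ∈ Finset.range (N + 1),
              (p : R) ^ i * x i ^ p ^ (N + 1 - 1 - i) * r -
                r * ((p : R) ^ i * x i ^ p ^ (N + 1 - 1 - i)) = (p : R) ^ (N + 1) * d i := by
            intro i hi
            have := Finset.mem_range.mp hi
            rw [mul_natCast_pow_mul, mul_assoc, ← mul_sub, Nat.add_sub_cancel, hd, ← mul_assoc,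
              ← pow_add]
            congr 2
            lia
          have hcomm : y * r - r * y = (p : R) ^ (N + 1) *
              (∑ i ∈ Finset.range (N + 1), d i - (p : R) * w') := by
            rw [hw, add_mul, mul_add, Finset.sum_mul, Finset.mul_sum, add_sub_add_comm,
              ← Finset.sum_sub_distrib, Finset.sum_congr rfl hsum, ← Finset.mul_sum,
              mul_natCast_pow_mul, mul_assoc, ← mul_sub, ← hw']
            noncomm_ring
          obtain ⟨z, hz⟩ := exists_eq_mul_of_pow_mul_eq htors (by lia) (hcomm.symm.trans hc')
          have h0 : ρ (∑ i ∈ Finset.range (N + 1), d i) = 0 := by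
            rw [h.map_eq_zero_iff]
            exact ⟨z + w', by rw [mul_add, ← hz, sub_add_cancel]⟩
          rw [map_sum] at h0
          simpa only [hρd] using h0
        refine ⟨u, hu, ?_⟩
        rw [← hxu, hw, Finset.sum_range_succ', map_add, map_add, map_sum]
        simp [h.natCast_eq_zero, pow_succ]
    obtain ⟨y', hy'⟩ : ∃ y', y - v ^ p ^ j = (p : R) * y' := by
      rw [← h.map_eq_zero_iff, map_sub, map_pow, hyv, sub_self]
    obtain ⟨x, hx, w, hw⟩ := ih (y := y') (by lia) fun r => by
      obtain ⟨c, hc⟩ := hy r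
      obtain ⟨c', hc'⟩ := h.exists_commutator_pow_eq hv r j
      have h1 : (p : R) * (y' * r - r * y' - (p : R) ^ j * (c - c')) = 0 := by
        have h2 : (p : R) * (y' * r - r * y') =
            (y * r - r * y) - (v ^ p ^ j * r - r * v ^ p ^ j) := by
          have := mul_natCast_pow_mul p 1 r y'
          rw [pow_one] at this
          rw [mul_sub, ← this, ← mul_assoc, ← hy']
          noncomm_ring
        rw [mul_sub, h2, hc, hc', pow_succ']
        noncomm_ring
      obtain ⟨z, hz⟩ := htors _ h1
      refine ⟨c - c' + (p : R) ^ (n - 1 - j) * z, ?_⟩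
      rw [mul_add, ← mul_assoc, ← pow_add, Nat.add_sub_cancel' (by lia), ← hz]
      simp
    refine ⟨fun i => Nat.casesOn i v x, fun i => by cases i <;> simp [hv, hx], w, ?_⟩
    rw [Finset.sum_range_succ', eq_add_of_sub_eq hy', hw, mul_add, Finset.mul_sum]
    have : ∀ i ∈ Finset.range j, (p : R) * ((p : R) ^ i * x i ^ p ^ (j - 1 - i)) =
        (p : R) ^ (i + 1) * x i ^ p ^ (j + 1 - 1 - (i + 1)) := by
      intro i hi
      rw [← mul_assoc, ← pow_succ']
      congr 3
      lia
    rw [Finset.sum_congr rfl this, ← mul_assoc, ← pow_succ']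
    simp only [pow_zero, one_mul, Nat.add_sub_cancel, Nat.sub_zero]
    abel

end IsModP

end Commutator

lemma pow_mem_frobSpan {p : ℕ} [Fact p.Prime] {S : Type*} [CommRing S] [CharP S p] {Q : Set S}
    {e : ℕ} (a : ℕ) {x : S} (hx : x ∈ frobSpan p Q e) : x ^ p ^ a ∈ frobSpan p Q (e + a) := by
  rw [frobSpan] at hx
  induction hx using Submodule.span_induction with
  | mem x h =>
    obtain ⟨q, hq, rfl⟩ := h
    refine Ideal.subset_span ⟨q, hq, ?_⟩
    simp only [← pow_mul, pow_add]
  | zero => rw [zero_pow (pow_ne_zero _ (Fact.out : p.Prime).ne_zero)]; exact zero_mem _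
  | add x y _ _ hx hy => rw [add_pow_char_pow]; exact add_mem hx hy
  | smul a x _ hx => rw [smul_eq_mul, mul_pow]; exact Ideal.mul_mem_left _ _ hx

/-- A relation between the Poisson brackets with a family of elements of the center of `R / pR`
forces the first of them to be, up to a Frobenius twist, a `p`-th power. -/
lemma SymplecticPoisson.exists_pow_eq_pow_of_sum_eq_zero {p : ℕ} [Fact p.Prime] {k S : Type u}
    [Field k] [CharP k p] [PerfectRing k p] [CommRing S] [Algebra k S] [Algebra.FiniteType k S]
    [Algebra.FormallySmooth k S] (P : SymplecticPoisson k S) {n : ℕ} (m : Set S)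
    {R R₁ : Type*} [Ring R] [Ring R₁] [Algebra k R₁] {ρ : R →+* R₁} (h : IsModP p ρ)
    (θ : Subalgebra.center k R₁ ≃ₐ[k] (S ⧸ frobSpan p m n))
    (hbr : ∀ (z w : R) (hz : ρ z ∈ Subalgebra.center k R₁) (hw : ρ w ∈ Subalgebra.center k R₁),
      ∃ c : R, (p : R) * c = z * w - w * z ∧ ∃ hc : ρ c ∈ Subalgebra.center k R₁, ∀ s t : S,
        Ideal.Quotient.mk (frobSpan p m n) s = θ ⟨ρ z, hz⟩ →
        Ideal.Quotient.mk (frobSpan p m n) t = θ ⟨ρ w, hw⟩ →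
        θ ⟨ρ c, hc⟩ = Ideal.Quotient.mk (frobSpan p m n) (P.bracket s t))
    {N : ℕ} (hN : N + 1 < n) {x : ℕ → R} (hx : ∀ i, ρ (x i) ∈ Subalgebra.center k R₁)
    (hsum : ∀ r, ρ r ∈ Subalgebra.center k R₁ → ∀ c : ℕ → R,
      (∀ i, x i * r - r * x i = (p : R) * c i) → (∀ i, ρ (c i) ∈ Subalgebra.center k R₁) →
      ∑ i ∈ Finset.range (N + 1), ρ (x i) ^ (p ^ (N - i) - 1) * ρ (c i) = 0) :
    ∃ u, ρ u ∈ Subalgebra.center k R₁ ∧ ρ (x 0) ^ p ^ N = ρ u ^ p ^ (N + 1) := by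
  choose s hs using fun i => Ideal.Quotient.mk_surjective (θ ⟨ρ (x i), hx i⟩)
  have lift : ∀ t : S, ∃ r, ∃ hr : ρ r ∈ Subalgebra.center k R₁,
      Ideal.Quotient.mk (frobSpan p m n) t = θ ⟨ρ r, hr⟩ := fun t => by
    obtain ⟨r, hr⟩ := h.surj (θ.symm (Ideal.Quotient.mk _ t)).1
    refine ⟨r, hr ▸ (θ.symm _).2, ?_⟩
    simp [hr]
  obtain ⟨u, hu⟩ : ∃ u, s 0 - u ^ p ∈ frobSpan p m (n - (N + 1) + 1) := by
    refine P.exists_sub_pow_mem m N (n - (N + 1)) s fun t => ?_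
    obtain ⟨r, hr, ht⟩ := lift t
    choose c hc hcc hθ using fun i => hbr (x i) r (hx i) hr
    have h0 := hsum r hr c (fun i => (hc i).symm) hcc
    have h1 : ∑ i ∈ Finset.range (N + 1), (⟨ρ (x i), hx i⟩ : Subalgebra.center k R₁) ^
        (p ^ (N - i) - 1) * ⟨ρ (c i), hcc i⟩ = 0 := Subtype.ext (by simpa using h0)
    have h2 := congrArg θ h1
    simp only [map_sum, map_mul, map_pow, map_zero, ← hs, hθ _ _ _ (hs _) ht] at h2
    rw [show n - (N + 1) + 1 + N = n by lia, ← Ideal.Quotient.eq_zero_iff_mem]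
    simpa only [map_sum, map_mul, map_pow] using h2
  obtain ⟨r, hr, ht⟩ := lift u
  refine ⟨r, hr, ?_⟩
  have hmem : s 0 ^ p ^ N - u ^ p ^ (N + 1) ∈ frobSpan p m n := by
    rcases subsingleton_or_nontrivial S with hS | hS
    · rw [Subsingleton.elim (s 0 ^ p ^ N - _) 0]
      exact zero_mem _
    · have : CharP S p := charP_of_injective_algebraMap (algebraMap k S).injective p
      have := pow_mem_frobSpan N hu
      rw [show n - (N + 1) + 1 + N = n by lia, sub_pow_char_pow, ← pow_mul, ← pow_succ'] at this
      exact this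
  have h3 : (⟨ρ (x 0), hx 0⟩ : Subalgebra.center k R₁) ^ p ^ N = ⟨ρ r, hr⟩ ^ p ^ (N + 1) := by
    apply θ.injective
    rw [map_pow, map_pow, ← hs, ← ht, ← map_pow, ← map_pow]
    exact Ideal.Quotient.eq.mpr hmem
  exact congrArg Subtype.val h3

/-- Let `k` be a perfect field of characteristic `p > 2` and `S` a smooth affine
`k`-algebra with a symplectic Poisson structure. Let `n ≥ 1`, let `m` be an ideal of `S` and
`B = S/m^{[pⁿ]}` with the induced Poisson bracket. Let `R` be a flat `W_n(k)`-algebra with a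
`k`-algebra isomorphism `θ : Z(R/pR) ≅ B` (the quotient `R/pR` is encoded by the surjection
`ρ : R → R₁` with kernel `pR`) such that the deformation Poisson bracket on `Z(R/pR)`
corresponds under `θ` to the bracket of `B`. Then
`Z(R) = {Σ_{i=1}^n p^{i−1}·x_i^{p^{n−i}} : x_i ∈ R, (x_i mod p) ∈ Z(R/pR)}` and
`Z(R) ∩ pR = {Σ_{i=2}^n p^{i−1}·x_i^{p^{n−i}} : x_i ∈ R, (x_i mod p) ∈ Z(R/pR)}`. -/
theorem stmt_1 (p : ℕ) [Fact p.Prime] (hp : 2 < p)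
    (k : Type u) [Field k] [CharP k p] [ExpChar k p] [PerfectRing k p]
    (S : Type u) [CommRing S] [Algebra k S]
    (hfg : Algebra.FiniteType k S) [Algebra.FormallySmooth k S]
    (P : SymplecticPoisson k S)
    (n : ℕ) (hn : 0 < n)
    (m : Ideal S)
    (R : Type*) [Ring R] [Algebra (TruncatedWittVector p n k) R]
    [Module.Flat (TruncatedWittVector p n k) R]
    (R₁ : Type*) [Ring R₁] [Algebra k R₁]
    (ρ : R →+* R₁) (hsurj : Function.Surjective ρ)
    (hker : ∀ x : R, ρ x = 0 ↔ ∃ y : R, x = (p : R) * y)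
    (hcompat : ∀ w : TruncatedWittVector p n k,
      ρ (algebraMap (TruncatedWittVector p n k) R w) =
        algebraMap k R₁ (TruncatedWittVector.coeff ⟨0, hn⟩ w))
    (θ : Subalgebra.center k R₁ ≃ₐ[k]
      (S ⧸ Ideal.span ((fun f : S => f ^ p ^ n) '' (m : Set S))))
    (hbr : ∀ (z w : R) (hz : ρ z ∈ Subalgebra.center k R₁)
        (hw : ρ w ∈ Subalgebra.center k R₁),
      ∃ c : R, (p : R) * c = z * w - w * z ∧
        ∃ hc : ρ c ∈ Subalgebra.center k R₁,
          ∀ s t : S,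
            Ideal.Quotient.mk (Ideal.span ((fun f : S => f ^ p ^ n) '' (m : Set S))) s =
              θ ⟨ρ z, hz⟩ →
            Ideal.Quotient.mk (Ideal.span ((fun f : S => f ^ p ^ n) '' (m : Set S))) t =
              θ ⟨ρ w, hw⟩ →
            θ ⟨ρ c, hc⟩ =
              Ideal.Quotient.mk (Ideal.span ((fun f : S => f ^ p ^ n) '' (m : Set S)))
                (P.bracket s t)) :
    (Subring.center R : Set R) =
        {r : R | ∃ x : Fin n → R, (∀ i, ρ (x i) ∈ Subalgebra.center k R₁) ∧
          r = ∑ i : Fin n, (p : R) ^ (i : ℕ) * x i ^ p ^ (n - 1 - (i : ℕ))} ∧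
      (Subring.center R : Set R) ∩ {r : R | ∃ y : R, r = (p : R) * y} =
        {r : R | ∃ x : Fin (n - 1) → R, (∀ i, ρ (x i) ∈ Subalgebra.center k R₁) ∧
          r = ∑ i : Fin (n - 1), (p : R) ^ ((i : ℕ) + 1) * x i ^ p ^ (n - 2 - (i : ℕ))} := by
  have h : IsModP p ρ := ⟨hsurj, hker⟩
  have hpn : (p : R) ^ n = 0 := by
    rw [← map_natCast (algebraMap (TruncatedWittVector p n k) R), ← map_pow,
      TruncatedWittVector.natCast_pow_eq_zero, map_zero]
  have htors : ∀ x : R, (p : R) * x = 0 → ∃ y, x = (p : R) ^ (n - 1) * y := fun x hx => by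
    obtain ⟨y, hy⟩ := Module.Flat.exists_eq_smul_of_smul_eq_zero
      (a := (p : TruncatedWittVector p n k)) (b := (p : TruncatedWittVector p n k) ^ (n - 1))
      (fun c => TruncatedWittVector.exists_eq_pow_mul_of_mul_eq_zero)
      (x := x) (by rwa [Algebra.smul_def, map_natCast])
    exact ⟨y, by rw [hy, Algebra.smul_def, map_pow, map_natCast]⟩
  have hmain {j : ℕ} (hj : j ≤ n) {y : R} (hy : ∀ r, ∃ c, y * r - r * y = (p : R) ^ j * c) :=
    h.exists_eq_sum_of_commutator hp Fact.out htors
      (fun z w hz hw => by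
        obtain ⟨c, hc, hcc, -⟩ := hbr z w hz hw
        exact ⟨c, hc, hcc⟩)
      (fun N hN x hx hsum => P.exists_pow_eq_pow_of_sum_eq_zero m h θ hbr hN hx hsum) hj hy
  refine ⟨Set.ext fun z => ⟨fun hz => ?_, ?_⟩, Set.ext fun z => ⟨?_, ?_⟩⟩
  · obtain ⟨x, hx, w, hw⟩ := hmain le_rfl (y := z) fun r =>
      ⟨0, by rw [Subring.mem_center_iff.mp hz r, sub_self, mul_zero]⟩
    refine ⟨fun i => x i, fun i => hx i, ?_⟩
    rw [hw, hpn, zero_mul, add_zero,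
      Fin.sum_univ_eq_sum_range fun i => (p : R) ^ i * x i ^ p ^ (n - 1 - i)]
  · rintro ⟨x, hx, rfl⟩
    exact sum_mem fun i _ => h.pow_mul_pow_mem_center hpn (hx i) (by lia)
  · rintro ⟨hz, y, rfl⟩
    obtain ⟨x, hx, w, hw⟩ := hmain (Nat.sub_le n 1) (y := y) fun r => htors _ (by
      have h1 := Subring.mem_center_iff.mp hz r
      have h2 := mul_natCast_pow_mul p 1 r y
      rw [pow_one] at h2
      rw [mul_sub, ← h2, h1, mul_assoc, sub_self])
    refine ⟨fun i => x i, fun i => hx i, ?_⟩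
    rw [hw, mul_add, ← mul_assoc _ _ w, ← pow_succ', Nat.sub_add_cancel hn, hpn, zero_mul,
      add_zero, Finset.mul_sum,
      Fin.sum_univ_eq_sum_range fun i => (p : R) ^ (i + 1) * x i ^ p ^ (n - 2 - i)]
    exact Finset.sum_congr rfl fun i _ => by rw [← mul_assoc, ← pow_succ', Nat.sub_sub n 1 1]
  · rintro ⟨x, hx, rfl⟩
    refine ⟨sum_mem fun i _ => h.pow_mul_pow_mem_center hpn (hx i) (by lia),
      ∑ i : Fin (n - 1), (p : R) ^ (i : ℕ) * x i ^ p ^ (n - 2 - (i : ℕ)), ?_⟩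
    rw [Finset.mul_sum]
    exact Finset.sum_congr rfl fun i _ => by rw [← mul_assoc, ← pow_succ']
end

section
/- Let S be a commutative k-algebra that is essentially of finite type over k and formally smooth over k. Let n ≥ 1 and let m be an ideal of the ring W_n(S) of length-n p-typical Witt vectors of S. Let m̄ ⊆ S be the image of m under the ring homomorphism W_n(S) → S sending a Witt vector to its first Witt coefficient. Assume that for every z ∈ m with Witt coefficients (z_1, …, z_n), one has Σ_{i=1}^n z_i^{p^{n−i}−1}·d z_i ∈ m̄^{[p^{n−1}]}·Ω¹_{S/k}. Then m̄ = (m̄ ∩ S^p)·S, i.e., the ideal m̄ is generated by the p-th powers it contains. -/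
universe u

section Derivation

variable {k S : Type*} [CommRing k] [CommRing S] [Algebra k S]

theorem Derivation.iterate_mul_eq_sum_antidiagonal (D : Derivation k S S) (n : ℕ) (f g : S) :
    D^[n] (f * g) =
      ∑ ij ∈ Finset.HasAntidiagonal.antidiagonal n,
        (n.choose ij.1 : S) * (D^[ij.1] f * D^[ij.2] g) := by
  induction n with
  | zero => simp
  | succ n ih =>
    rw [Finset.sum_antidiagonal_choose_succ_mul (fun i j ↦ D^[i] f * D^[j] g),
      Function.iterate_succ_apply', ih, map_sum, ← Finset.sum_add_distrib]
    refine Finset.sum_congr rfl fun ij hij ↦ ?_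
    rw [Nat.choose_symm_of_eq_add (Finset.HasAntidiagonal.mem_antidiagonal.1 hij).symm]
    simp only [Derivation.leibniz, smul_eq_mul, Function.iterate_succ_apply',
      Derivation.map_natCast]
    ring

theorem Derivation.map_pow_char (p : ℕ) [CharP S p] (D : Derivation k S S) (f : S) :
    D (f ^ p) = 0 := by
  simp [Derivation.leibniz_pow]

theorem Derivation.map_pow_char_mul (p : ℕ) [CharP S p] (D : Derivation k S S) (f g : S) :
    D (f ^ p * g) = f ^ p * D g := by
  simp [D.map_pow_char p]

theorem Derivation.iterate_pow_char_mul (p : ℕ) [CharP S p] (D : Derivation k S S) (f g : S)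
    (n : ℕ) : D^[n] (f ^ p * g) = f ^ p * D^[n] g := by
  induction n with
  | zero => rfl
  | succ n ih => rw [Function.iterate_succ_apply', ih, D.map_pow_char_mul p,
      Function.iterate_succ_apply']

theorem Derivation.iterate_char_mul (p : ℕ) [hp : Fact p.Prime] [CharP S p]
    (D : Derivation k S S) (f g : S) :
    D^[p] (f * g) = f * D^[p] g + g * D^[p] f := by
  have hp0 := hp.out.ne_zero
  rw [D.iterate_mul_eq_sum_antidiagonal, ← Finset.sum_subset
    (s₁ := {(0, p), (p, 0)}) (by intro x; aesop) ?_, Finset.sum_pair (by simp; omega)]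
  · simp [mul_comm g]
  · rintro ⟨i, j⟩ h₁ h₂
    simp only [Finset.HasAntidiagonal.mem_antidiagonal, Finset.mem_insert, Finset.mem_singleton,
      Prod.mk.injEq, not_or] at h₁ h₂
    rw [(CharP.cast_eq_zero_iff S p _).2
      (hp.out.dvd_choose_self (by omega) (by omega)), zero_mul]

/-- In characteristic `p`, the `p`-th power of a derivation is a derivation. -/
def Derivation.powChar (p : ℕ) [Fact p.Prime] [CharP S p] (D : Derivation k S S) :
    Derivation k S S :=
  Derivation.mk' ((D : S →ₗ[k] S) ^ p) fun f g ↦ by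
    simpa [Module.End.pow_apply] using D.iterate_char_mul p f g

theorem Derivation.powChar_apply (p : ℕ) [Fact p.Prime] [CharP S p] (D : Derivation k S S)
    (f : S) : D.powChar p f = D^[p] f := by
  simp [Derivation.powChar, Module.End.pow_apply]

end Derivation

section Hochschild

open Polynomial

theorem Polynomial.coeff_pow_pred_mul_derivative {A : Type*} [CommRing A] (n : ℕ) (hn : 0 < n)
    (G : A[X]) : (G ^ (n - 1) * derivative G).coeff (n - 1) = (G ^ n).coeff n := by
  obtain ⟨G, rfl⟩ := Polynomial.map_surjective (MvPolynomial.aeval (id : A → A) :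
    MvPolynomial A ℤ →ₐ[ℤ] A).toRingHom (fun a ↦ ⟨MvPolynomial.X a, by simp⟩) G
  rw [derivative_map, ← Polynomial.map_pow, ← Polynomial.map_mul, ← Polynomial.map_pow,
    coeff_map, coeff_map]
  congr 1
  have h := congr_arg (coeff · (n - 1)) (derivative_pow G n)
  simp only [coeff_derivative, mul_assoc, coeff_C_mul, Nat.sub_add_cancel hn] at h
  have hn' : (n : MvPolynomial A ℤ) ≠ 0 := by exact_mod_cast hn.ne'
  refine mul_left_cancel₀ hn' ?_
  rw [← h, ← Nat.cast_succ, Nat.succ_eq_add_one, Nat.sub_add_cancel hn, mul_comm]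

theorem Polynomial.coeff_pow_char_self {A : Type*} [CommRing A] (p : ℕ) [hp : Fact p.Prime]
    [CharP A p] (G : A[X]) : (G ^ p).coeff p = G.coeff 1 ^ p := by
  rw [← Polynomial.map_frobenius_expand, coeff_map,
    show (expand A p G).coeff p = G.coeff 1 by
      simpa using coeff_expand_mul hp.out.pos G 1, frobenius_def]

variable {k S : Type*} [Field k] [CommRing S] [Algebra k S]

/-- The Taylor expansion of `f` along a derivation, truncated in degree `p`. -/
noncomputable def Derivation.truncTaylor (p : ℕ) (D : Derivation k S S) (f : S) : S[X] :=
  ∑ i ∈ Finset.range p, monomial i (algebraMap k S (i.factorial : k)⁻¹ * D^[i] f)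

theorem Derivation.coeff_truncTaylor (p : ℕ) (D : Derivation k S S) (f : S) {n : ℕ}
    (hn : n < p) :
    (D.truncTaylor p f).coeff n = algebraMap k S (n.factorial : k)⁻¹ * D^[n] f := by
  simp [truncTaylor, Polynomial.coeff_monomial, hn]

variable (p : ℕ) [hp : Fact p.Prime] [CharP k p]

theorem Nat.cast_factorial_ne_zero_of_lt_char {n : ℕ} (hn : n < p) : (n.factorial : k) ≠ 0 := by
  rw [Ne, CharP.cast_eq_zero_iff k p, hp.out.dvd_factorial]
  omega

theorem Derivation.X_pow_dvd_truncTaylor_mul (D : Derivation k S S) (f g : S) :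
    X ^ p ∣ D.truncTaylor p (f * g) - D.truncTaylor p f * D.truncTaylor p g := by
  rw [X_pow_dvd_iff]
  intro n hn
  rw [coeff_sub, sub_eq_zero, D.coeff_truncTaylor p _ hn, coeff_mul,
    D.iterate_mul_eq_sum_antidiagonal, Finset.mul_sum]
  refine Finset.sum_congr rfl fun ⟨i, j⟩ hij ↦ ?_
  rw [Finset.HasAntidiagonal.mem_antidiagonal] at hij
  dsimp only at hij ⊢
  subst hij
  rw [D.coeff_truncTaylor p _ (by omega), D.coeff_truncTaylor p _ (by omega)]
  have h : ((i + j).factorial : k)⁻¹ * ((i + j).choose i : k) =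
      (i.factorial : k)⁻¹ * (j.factorial : k)⁻¹ := by
    have h₁ := Nat.cast_factorial_ne_zero_of_lt_char (k := k) p hn
    have h₂ := Nat.cast_factorial_ne_zero_of_lt_char (k := k) p (n := i) (by omega)
    have h₃ := Nat.cast_factorial_ne_zero_of_lt_char (k := k) p (n := j) (by omega)
    have := congr_arg (Nat.cast (R := k)) (Nat.add_choose_mul_factorial_mul_factorial i j)
    push_cast at this
    field_simp
    rw [← this, Nat.choose_symm_add]
  have := congr_arg (algebraMap k S) h
  simp only [map_mul, _root_.map_natCast] at this
  rw [← mul_assoc, this]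
  ring

theorem Derivation.X_pow_dvd_truncTaylor_pow (D : Derivation k S S) (f : S) (n : ℕ) :
    X ^ p ∣ D.truncTaylor p (f ^ n) - D.truncTaylor p f ^ n := by
  induction n with
  | zero =>
    rw [X_pow_dvd_iff]
    intro n hn
    rw [coeff_sub, sub_eq_zero, D.coeff_truncTaylor p _ hn]
    cases n with
    | zero => simp
    | succ n => simp [coeff_one, iterate_map_zero]
  | succ n ih =>
    have := dvd_add (D.X_pow_dvd_truncTaylor_mul p (f ^ n) f)
      (ih.mul_right (D.truncTaylor p f))
    convert this using 1
    rw [pow_succ f, pow_succ (D.truncTaylor p f)]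
    ring

/-- Hochschild's formula. -/
theorem Derivation.iterate_pred_char_pow_pred_mul (D : Derivation k S S) [CharP S p] (g : S) :
    D^[p - 1] (g ^ (p - 1) * D g) = g ^ (p - 1) * D^[p] g - D g ^ p := by
  have hp1 := hp.out.one_lt
  have hlt : p - 1 < p := by omega
  set G := D.truncTaylor p g
  have h₁ : X ^ p ∣ D.truncTaylor p (D g) -
      (derivative G + monomial (p - 1) (algebraMap k S ((p - 1).factorial : k)⁻¹ * D^[p] g)) := by
    rw [X_pow_dvd_iff]
    intro n hn
    rw [coeff_sub, sub_eq_zero, D.coeff_truncTaylor p _ hn, coeff_add, coeff_derivative,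
      coeff_monomial, ← Function.iterate_succ_apply]
    split_ifs with h
    · subst h
      have : ((p - 1 : ℕ) : S) + 1 = 0 := by
        rw [← Nat.cast_add_one, Nat.sub_add_cancel hp1.le, CharP.cast_eq_zero]
      rw [this, mul_zero, zero_add, Nat.succ_eq_add_one, Nat.sub_add_cancel hp1.le]
    · have hn' : n + 1 < p := by omega
      have h₂ := Nat.cast_factorial_ne_zero_of_lt_char (k := k) p hn'
      rw [Nat.factorial_succ, Nat.cast_mul] at h₂
      have : (n.factorial : k)⁻¹ = ((n + 1).factorial : k)⁻¹ * (n + 1 : ℕ) := by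
        rw [Nat.factorial_succ, Nat.cast_mul]
        have := left_ne_zero_of_mul h₂
        have := right_ne_zero_of_mul h₂
        field_simp
      rw [D.coeff_truncTaylor p _ hn', this, map_mul, _root_.map_natCast]
      push_cast
      ring
  have h₂ : X ^ p ∣ D.truncTaylor p (g ^ (p - 1) * D g) - G ^ (p - 1) *
      (derivative G + monomial (p - 1) (algebraMap k S ((p - 1).factorial : k)⁻¹ * D^[p] g)) := by
    have := dvd_add (dvd_add (D.X_pow_dvd_truncTaylor_mul p (g ^ (p - 1)) (D g))
      ((D.X_pow_dvd_truncTaylor_pow p g (p - 1)).mul_right (D.truncTaylor p (D g))))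
      (h₁.mul_left (G ^ (p - 1)))
    convert this using 1
    ring
  rw [X_pow_dvd_iff] at h₂
  have h₃ := h₂ (p - 1) hlt
  have hG0 : G.coeff 0 = g := by simp [G, D.coeff_truncTaylor p g hp.out.pos]
  have hG1 : G.coeff 1 = D g := by simp [G, D.coeff_truncTaylor p g hp1]
  have hm := coeff_mul_monomial (G ^ (p - 1)) (p - 1) 0
    (algebraMap k S ((p - 1).factorial : k)⁻¹ * D^[p] g)
  rw [zero_add] at hm
  rw [coeff_sub, sub_eq_zero, D.coeff_truncTaylor p _ hlt, mul_add, coeff_add,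
    Polynomial.coeff_pow_pred_mul_derivative p hp.out.pos, Polynomial.coeff_pow_char_self, hm,
    coeff_zero_eq_eval_zero, eval_pow, ← coeff_zero_eq_eval_zero, hG0, hG1] at h₃
  have hw : ((p - 1).factorial : k)⁻¹ = -1 := by
    have := congr_arg (ZMod.castHom (dvd_refl p) k) (ZMod.wilsons_lemma p)
    rw [_root_.map_natCast, _root_.map_neg, map_one] at this
    rw [this, inv_neg, inv_one]
  rw [hw, _root_.map_neg, map_one] at h₃
  linear_combination -h₃

end Hochschild

section FrobeniusPower

theorem Derivation.iterate_mem_map_frobenius {k S : Type*} [CommRing k] [CommRing S] [Algebra k S]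
    (p : ℕ) [Fact p.Prime] [CharP S p] (D : Derivation k S S) (J : Ideal S) (n : ℕ) {x : S}
    (hx : x ∈ J.map (frobenius S p)) : D^[n] x ∈ J.map (frobenius S p) := by
  have h : ∀ x ∈ J.map (frobenius S p), D x ∈ J.map (frobenius S p) := by
    intro x hx
    induction hx using Submodule.span_induction with
    | mem x hx =>
      obtain ⟨y, -, rfl⟩ := hx
      rw [frobenius_def, D.map_pow_char p]
      exact zero_mem _
    | zero => simp
    | add x y _ _ hx hy => rw [_root_.map_add]; exact add_mem hx hy
    | smul a x hx hx' =>
      rw [smul_eq_mul, D.leibniz]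
      exact add_mem (Ideal.mul_mem_left _ _ hx') (Ideal.mul_mem_right _ _ hx)
  induction n with
  | zero => exact hx
  | succ n ih => rw [Function.iterate_succ_apply']; exact h _ ih

theorem Ideal.map_iterateFrobenius_succ {S : Type*} [CommRing S] (p : ℕ) [Fact p.Prime] [CharP S p]
    (J : Ideal S) (n : ℕ) : J.map (iterateFrobenius S p (n + 1)) =
      (J.map (iterateFrobenius S p n)).map (frobenius S p) := by
  rw [Ideal.map_map]
  congr 1
  ext x
  simp [iterateFrobenius_def, frobenius_def, pow_succ, pow_mul]

/-- Inverting the Cartier operator: `J`-divisibility of `F ^ n` of an exact Witt vector differential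
gives `J`-divisibility of the differential of its first coefficient. -/
theorem Derivation.apply_mem_of_sum_mem_map_iterateFrobenius {k S : Type*} [Field k] [CommRing S]
    [Algebra k S] (p : ℕ) [hp : Fact p.Prime] [CharP k p] [CharP S p]
    (hS : ∀ (J : Ideal S) (a : S), a ^ p ∈ J.map (frobenius S p) → a ∈ J)
    (J : Ideal S) (z : ℕ → S) (n : ℕ)
    (h : ∀ D : Derivation k S S, ∑ j ∈ Finset.range (n + 1), z j ^ (p ^ (n - j) - 1) * D (z j) ∈
      J.map (iterateFrobenius S p n)) (D : Derivation k S S) : D (z 0) ∈ J := by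
  induction n generalizing D with
  | zero =>
    have : iterateFrobenius S p 0 = RingHom.id S := by ext; simp
    simpa [this] using h D
  | succ n ih =>
    refine ih (fun D ↦ hS _ _ ?_) D
    rw [← Ideal.map_iterateFrobenius_succ]
    have hD := h D
    have hDp := h (D.powChar p)
    rw [Ideal.map_iterateFrobenius_succ] at hD hDp ⊢
    convert sub_mem hDp (D.iterate_mem_map_frobenius p _ (p - 1) hD) using 1
    have hadd (m : ℕ) (s : Finset ℕ) (f : ℕ → S) : D^[m] (∑ j ∈ s, f j) = ∑ j ∈ s, D^[m] (f j) := by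
      induction m with
      | zero => rfl
      | succ m ih => simp only [Function.iterate_succ_apply', ih, _root_.map_sum]
    rw [hadd, ← Finset.sum_sub_distrib, Finset.sum_range_succ _ (n + 1), sum_pow_char]
    simp only [D.powChar_apply p]
    have hlast : z (n + 1) ^ (p ^ (n + 1 - (n + 1)) - 1) * D^[p] (z (n + 1)) -
        D^[p - 1] (z (n + 1) ^ (p ^ (n + 1 - (n + 1)) - 1) * D (z (n + 1))) = 0 := by
      obtain ⟨q, hq⟩ := Nat.exists_eq_add_one.2 hp.out.pos
      simp [hq]
    rw [hlast, add_zero]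
    refine Finset.sum_congr rfl fun j hj ↦ ?_
    rw [Finset.mem_range] at hj
    have he : p ^ (n + 1 - j) - 1 = (p ^ (n - j) - 1) * p + (p - 1) := by
      have h₁ : 1 ≤ p ^ (n - j) := Nat.one_le_pow _ _ hp.out.pos
      have h₂ := hp.out.pos
      rw [Nat.sub_add_comm (by omega), pow_succ, Nat.sub_mul, one_mul]
      have : p ≤ p ^ (n - j) * p := Nat.le_mul_of_pos_left _ (by omega)
      omega
    rw [he, pow_add, pow_mul, mul_assoc, mul_assoc, D.iterate_pow_char_mul p,
      D.iterate_pred_char_pow_pred_mul p]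
    ring

end FrobeniusPower

section MvPolynomial

open MvPolynomial

variable {ι k : Type*} [Field k]

/-- The linear map on polynomials keeping the monomials whose exponents are divisible by `p`, and
dividing these exponents by `p`. It is left inverse to `MvPolynomial.expand p`. -/
noncomputable def MvPolynomial.contractₗ (p : ℕ) : MvPolynomial ι k →ₗ[k] MvPolynomial ι k := by
  classical
  exact (basisMonomials ι k).constr k fun a ↦
    if ∀ i, p ∣ a i then monomial (a.mapRange (· / p) (Nat.zero_div p)) 1 else 0

open Classical in
theorem MvPolynomial.contractₗ_monomial (p : ℕ) (a : ι →₀ ℕ) (c : k) :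
    contractₗ p (monomial a c) =
    if ∀ i, p ∣ a i then monomial (a.mapRange (· / p) (Nat.zero_div p)) c else 0 := by
  have h := (basisMonomials ι k).constr_basis k (fun a ↦ if ∀ i, p ∣ a i then
    (monomial (a.mapRange (· / p) (Nat.zero_div p)) 1 : MvPolynomial ι k) else 0) a
  rw [coe_basisMonomials] at h
  rw [show monomial a c = c • monomial a (1 : k) by simp [smul_monomial], map_smul, contractₗ]
  refine (congr_arg (c • ·) h).trans ?_
  split_ifs <;> simp [smul_monomial]

theorem MvPolynomial.contractₗ_expand_mul {p : ℕ} (hp : 0 < p) (f g : MvPolynomial ι k) :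
    contractₗ p (expand p f * g) = f * contractₗ p g := by
  classical
  induction f using MvPolynomial.induction_on' with
  | add f f' h h' => simp only [map_add, add_mul, h, h']
  | monomial a c =>
    induction g using MvPolynomial.induction_on' with
    | add g g' h h' => simp only [map_add, mul_add, h, h']
    | monomial b d =>
      have hiff : (∀ i, p ∣ (p • a + b) i) ↔ ∀ i, p ∣ b i := by
        refine forall_congr' fun i ↦ ?_
        simp [Nat.dvd_add_right]
      rw [expand_monomial, monomial_mul, contractₗ_monomial, contractₗ_monomial]
      simp only [hiff]
      split_ifs with h
      · have he : (p • a + b).mapRange (· / p) (Nat.zero_div p) =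
            a + b.mapRange (· / p) (Nat.zero_div p) := by
          ext i
          simp [Nat.mul_add_div hp]
        rw [monomial_mul, he]
      · simp

theorem MvPolynomial.expand_contractₗ_of_pderiv_eq_zero (p : ℕ) [Fact p.Prime] [CharP k p]
    {f : MvPolynomial ι k} (hf : ∀ i, pderiv i f = 0) : expand p (contractₗ p f) = f := by
  classical
  conv_lhs => rw [f.as_sum]
  conv_rhs => rw [f.as_sum]
  rw [map_sum, map_sum]
  refine Finset.sum_congr rfl fun a ha ↦ ?_
  have h : ∀ i, p ∣ a i := by
    intro i
    by_contra h
    have h0 : a i ≠ 0 := fun h0 ↦ h (h0 ▸ dvd_zero p)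
    have h1 := coeff_pderiv (i := i) f (a - Finsupp.single i 1)
    have h2 : a - Finsupp.single i 1 + Finsupp.single i 1 = a :=
      tsub_add_cancel_of_le (by simpa [Nat.one_le_iff_ne_zero] using h0)
    rw [hf, h2, coeff_zero, eq_comm, mul_eq_zero, or_iff_right (mem_support_iff.1 ha)] at h1
    rw [Finsupp.tsub_apply, Finsupp.single_eq_same, ← Nat.cast_add_one,
      Nat.sub_add_cancel (Nat.one_le_iff_ne_zero.2 h0), CharP.cast_eq_zero_iff k p] at h1
    exact h h1
  have he : p • a.mapRange (· / p) (Nat.zero_div p) = a := by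
    ext i
    simp [Nat.mul_div_cancel' (h i)]
  rw [contractₗ_monomial, if_pos h, expand_monomial, he]

theorem MvPolynomial.expand_eq_pow (p : ℕ) [Fact p.Prime] [CharP k p] [PerfectRing k p]
    (f : MvPolynomial ι k) :
    expand p f = map ((frobeniusEquiv k p).symm : k →+* k) f ^ p := by
  rw [← map_frobenius_expand, map_expand, map_map]
  congr 1
  have : (frobenius k p).comp ((frobeniusEquiv k p).symm : k →+* k) = RingHom.id k := by
    ext x
    simp
  rw [this, map_id]

/-- The Frobenius of a polynomial ring over a perfect field contracts extended ideals. -/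
theorem MvPolynomial.mem_of_pow_mem_map_frobenius (p : ℕ) [hp : Fact p.Prime] [CharP k p]
    [PerfectRing k p] (J : Ideal (MvPolynomial ι k))
    {a : MvPolynomial ι k} (ha : a ^ p ∈ J.map (frobenius (MvPolynomial ι k) p)) : a ∈ J := by
  let e : MvPolynomial ι k →+* MvPolynomial ι k := map ((frobeniusEquiv k p).symm : k →+* k)
  have key (f g : MvPolynomial ι k) : e (contractₗ p (f ^ p * g)) = f * e (contractₗ p g) := by
    have h₁ : e (map (frobenius k p) f) = f := by
      have : ((frobeniusEquiv k p).symm : k →+* k).comp (frobenius k p) = RingHom.id k := by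
        ext x
        simp
      rw [map_map, this, map_id]
    rw [← map_frobenius_expand, map_expand, contractₗ_expand_mul hp.out.pos, map_mul, h₁]
  have h1 : e (contractₗ p 1) = 1 := by
    classical
    rw [← C_1, ← monomial_zero', contractₗ_monomial, if_pos (by simp)]
    simp [monomial_zero']
  have h (x : MvPolynomial ι k) (hx : x ∈ J.map (frobenius (MvPolynomial ι k) p)) :
      ∀ g, e (contractₗ p (x * g)) ∈ J := by
    induction hx using Submodule.span_induction with
    | mem x hx =>
      obtain ⟨y, hy, rfl⟩ := hx
      intro g
      rw [frobenius_def, key]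
      exact Ideal.mul_mem_right _ _ hy
    | zero => simp
    | add x y _ _ hx hy => intro g; simpa only [add_mul, map_add] using add_mem (hx g) (hy g)
    | smul c x _ hx =>
      intro g
      rw [smul_eq_mul, mul_comm c, mul_assoc]
      exact hx _
  have := h _ ha 1
  rwa [key, h1, mul_one] at this

theorem MvPolynomial.iterate_pderiv_char (p : ℕ) [hp : Fact p.Prime] [CharP k p] (i : ι)
    (f : MvPolynomial ι k) :
    (pderiv i)^[p] f = 0 := by
  classical
  have : (pderiv (R := k) i).powChar p = 0 := by
    refine MvPolynomial.derivation_ext fun j ↦ ?_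
    obtain ⟨q, hq⟩ := Nat.exists_eq_add_of_le hp.out.two_le
    rw [Derivation.powChar_apply, hq, add_comm, Function.iterate_add_apply]
    have : (pderiv i)^[2] (X j : MvPolynomial ι k) = 0 := by
      rw [Function.iterate_succ_apply, Function.iterate_one, pderiv_X, Pi.single_apply]
      split_ifs <;> simp
    rw [this, iterate_map_zero]
    rfl
  rw [← Derivation.powChar_apply, this, Derivation.zero_apply]

theorem MvPolynomial.pderiv_comm (i j : ι) (f : MvPolynomial ι k) :
    pderiv i (pderiv j f) = pderiv j (pderiv i f) := by
  classical
  have : ⁅pderiv (R := k) i, pderiv (R := k) j⁆ = 0 := by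
    refine MvPolynomial.derivation_ext fun l ↦ ?_
    rw [Derivation.commutator_apply, pderiv_X, pderiv_X, Pi.single_apply, Pi.single_apply]
    split_ifs <;> simp
  rw [← sub_eq_zero, ← Derivation.commutator_apply, this, Derivation.zero_apply]

theorem Derivation.iterate_pow_mul_of_apply_eq_zero {S : Type*} [CommRing S] [Algebra k S]
    (D : Derivation k S S) {x g : S} (hx : D x = 1) (hg : D g = 0) (n : ℕ) :
    D^[n] (x ^ n * g) = n.factorial * g := by
  induction n with
  | zero => simp
  | succ n ih =>
    have hsmul (m c : ℕ) (f : S) : D^[m] (c * f) = c * D^[m] f := by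
      induction m with
      | zero => rfl
      | succ m ih => simp [Function.iterate_succ_apply', ih]
    have hD : D (x ^ (n + 1) * g) = (n + 1 : ℕ) * (x ^ n * g) := by
      simp [hg, D.leibniz_pow, hx]; ring
    rw [Function.iterate_succ_apply, hD, hsmul, ih, Nat.factorial_succ]
    push_cast
    ring

theorem MvPolynomial.le_span_of_pderiv_mem_aux (p : ℕ) [Fact p.Prime] [CharP k p]
    (L : Ideal (MvPolynomial ι k)) (hL : ∀ i, ∀ f ∈ L, pderiv i f ∈ L) (t : Finset ι) :
    L ≤ Ideal.span {f | f ∈ L ∧ ∀ i ∈ t, pderiv i f = 0} := by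
  classical
  have hLn (i : ι) (n : ℕ) : ∀ f ∈ L, (pderiv i)^[n] f ∈ L := by
    intro f hf
    induction n with
    | zero => exact hf
    | succ n ih => rw [Function.iterate_succ_apply']; exact hL _ _ ih
  induction t using Finset.induction_on with
  | empty => simp
  | insert j t hj ih =>
    refine ih.trans (Ideal.span_le.2 ?_)
    suffices h : ∀ n ≤ p, ∀ f ∈ L, (∀ i ∈ t, pderiv i f = 0) → (pderiv j)^[n] f = 0 →
        f ∈ Ideal.span {f | f ∈ L ∧ ∀ i ∈ insert j t, pderiv i f = 0} from
      fun f hf ↦ h p le_rfl f hf.1 hf.2 (iterate_pderiv_char p j f)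
    intro n
    induction n with
    | zero =>
      intro _ f _ _ hf
      rw [Function.iterate_zero_apply] at hf
      rw [hf]
      exact zero_mem _
    | succ n ihn =>
      intro hn f hfL hft hf
      set g := (pderiv j)^[n] f with hg
      have hgL : g ∈ L := hLn j n f hfL
      have hgj : pderiv j g = 0 := by rwa [Function.iterate_succ_apply'] at hf
      have hcomm (i : ι) (m : ℕ) : pderiv i ((pderiv j)^[m] f) = (pderiv j)^[m] (pderiv i f) := by
        induction m with
        | zero => rfl
        | succ m ih => rw [Function.iterate_succ_apply', pderiv_comm, ih,
            Function.iterate_succ_apply']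
      have hgt : ∀ i ∈ t, pderiv i g = 0 := by
        intro i hi
        rw [hg, hcomm, hft i hi, iterate_map_zero]
      have hgs : g ∈ Ideal.span {f | f ∈ L ∧ ∀ i ∈ insert j t, pderiv i f = 0} :=
        Ideal.subset_span ⟨hgL, by simpa [hgj] using hgt⟩
      set c : k := (n.factorial : k)⁻¹
      have hc : c * n.factorial = 1 :=
        inv_mul_cancel₀ (Nat.cast_factorial_ne_zero_of_lt_char p (by omega))
      have hgs' : c • (X j ^ n * g) ∈
          Ideal.span {f | f ∈ L ∧ ∀ i ∈ insert j t, pderiv i f = 0} := by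
        rw [smul_eq_C_mul]
        exact Ideal.mul_mem_left _ _ (Ideal.mul_mem_left _ _ hgs)
      have hsmul (m : ℕ) (u v : MvPolynomial ι k) :
          (pderiv j)^[m] (u - c • v) = (pderiv j)^[m] u - c • (pderiv j)^[m] v := by
        induction m with
        | zero => rfl
        | succ m ih => simp only [Function.iterate_succ_apply', ih, map_sub, Derivation.map_smul]
      have := ihn (by omega) (f - c • (X j ^ n * g)) (sub_mem hfL (by
          rw [smul_eq_C_mul]
          exact Ideal.mul_mem_left _ _ (Ideal.mul_mem_left _ _ hgL))) ?_ ?_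
      · simpa using add_mem this hgs'
      · intro i hi
        have hij : j ≠ i := by rintro rfl; exact hj hi
        simp [hft i hi, hgt i hi, pderiv_X_of_ne hij]
      · rw [hsmul, Derivation.iterate_pow_mul_of_apply_eq_zero _ (pderiv_X_self j) hgj, ← hg,
          ← map_natCast (C : k →+* MvPolynomial ι k), smul_eq_C_mul, ← mul_assoc, ← C_mul, hc,
          C_1, one_mul, sub_self]

/-- An ideal of a polynomial ring over a perfect field stable under all partial derivatives is
generated by the `p`-th powers it contains. -/
theorem MvPolynomial.le_span_of_pderiv_mem [Fintype ι] (p : ℕ) [Fact p.Prime] [CharP k p]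
    [PerfectRing k p] (L : Ideal (MvPolynomial ι k))
    (hL : ∀ i, ∀ f ∈ L, pderiv i f ∈ L) :
    L ≤ Ideal.span {f | f ∈ L ∧ ∃ g, f = g ^ p} := by
  refine (le_span_of_pderiv_mem_aux p L hL Finset.univ).trans (Ideal.span_mono ?_)
  rintro f ⟨hf, hf'⟩
  refine ⟨hf, map ((frobeniusEquiv k p).symm : k →+* k) (contractₗ p f), ?_⟩
  rw [← expand_eq_pow, expand_contractₗ_of_pderiv_eq_zero p (by simpa using hf')]

end MvPolynomial

section Localization

/-- A derivation of a ring extends to its localizations. -/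
theorem Derivation.exists_extend_isLocalization {k A : Type*} [CommRing k] [CommRing A]
    [Algebra k A] (M : Submonoid A) (R : Type*) [CommRing R] [Algebra k R] [Algebra A R]
    [IsScalarTower k A R] [IsLocalization M R] (d : Derivation k A A) :
    ∃ D : Derivation k R R, ∀ x, D (algebraMap A R x) = algebraMap A R (d x) := by
  have := KaehlerDifferential.isLocalizedModule_map k A R M
  refine ⟨(IsLocalizedModule.mapExtendScalars M (KaehlerDifferential.map k k A R)
    (Algebra.linearMap A R) R d.liftKaehlerDifferential).compDer (KaehlerDifferential.D k R),
    fun x ↦ ?_⟩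
  have h := IsLocalizedModule.map_apply M (KaehlerDifferential.map k k A R)
    (Algebra.linearMap A R) d.liftKaehlerDifferential (KaehlerDifferential.D k A x)
  rw [KaehlerDifferential.map_D, Derivation.liftKaehlerDifferential_comp_D] at h
  exact (IsLocalizedModule.mapExtendScalars_apply_apply M _ _ R _ _).trans h

theorem IsLocalization.mem_of_pow_mem_map_frobenius {A : Type*} [CommRing A] (p : ℕ)
    [hp : Fact p.Prime] [CharP A p] (M : Submonoid A) (R : Type*) [CommRing R] [Algebra A R]
    [IsLocalization M R] [CharP R p]
    (hA : ∀ (J : Ideal A) (a : A), a ^ p ∈ J.map (frobenius A p) → a ∈ J)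
    (J : Ideal R) (a : R) (ha : a ^ p ∈ J.map (frobenius R p)) : a ∈ J := by
  obtain ⟨x, s, rfl⟩ := IsLocalization.exists_mk'_eq M a
  rw [IsLocalization.mk'_mem_iff, ← Ideal.mem_comap]
  have h₁ : algebraMap A R (x ^ p) ∈
      ((J.comap (algebraMap A R)).map (frobenius A p)).map (algebraMap A R) := by
    rw [Ideal.map_map, RingHom.frobenius_comm, ← Ideal.map_map]
    have := IsLocalization.map_under M R J
    rw [Ideal.under_def] at this
    rw [this]
    have hx := IsLocalization.mk'_spec R x s
    rw [map_pow, ← hx, mul_pow]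
    exact Ideal.mul_mem_right _ _ ha
  obtain ⟨t, ht, htx⟩ := (IsLocalization.algebraMap_mem_map_algebraMap_iff M R _ _).1 h₁
  have h₂ : t * x ∈ J.comap (algebraMap A R) := by
    refine hA _ _ ?_
    obtain ⟨q, hq⟩ := Nat.exists_eq_add_one.2 hp.out.pos
    have := Ideal.mul_mem_left _ (t ^ q) htx
    rwa [← mul_assoc, ← pow_succ, ← hq, ← mul_pow] at this
  rw [Ideal.mem_comap, map_mul] at h₂
  exact (Ideal.unit_mul_mem_iff_mem _ (IsLocalization.map_units R ⟨t, ht⟩)).1 h₂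

end Localization

section FormallySmooth

/-- If `Ω[S⁄k]` is projective, an ideal stable under all derivations of `S` is stable under all
derivations with values in an `S`-algebra. -/
theorem Derivation.apply_mem_map_of_forall_apply_mem {k S T : Type*} [CommRing k] [CommRing S]
    [CommRing T] [Algebra k S] [Algebra k T] [Algebra S T] [IsScalarTower k S T]
    [Module.Projective S (KaehlerDifferential k S)] {I : Ideal S}
    (hI : ∀ D : Derivation k S S, ∀ f ∈ I, D f ∈ I) (Δ : Derivation k S T) {f : S} (hf : f ∈ I) :
    Δ f ∈ I.map (algebraMap S T) := by
  obtain ⟨s, hs⟩ := Module.projective_def'.1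
    (inferInstance : Module.Projective S (KaehlerDifferential k S))
  have h := congr_arg Δ.liftKaehlerDifferential
    (LinearMap.congr_fun hs (KaehlerDifferential.D k S f))
  rw [LinearMap.id_apply, Derivation.liftKaehlerDifferential_comp_D, LinearMap.comp_apply,
    Finsupp.linearCombination_apply, Finsupp.sum, map_sum] at h
  rw [← h]
  refine sum_mem fun ω _ ↦ ?_
  rw [_root_.map_smul, Algebra.smul_def]
  refine Ideal.mul_mem_right _ _ (Ideal.mem_map_of_mem _ ?_)
  exact hI (((Finsupp.lapply ω).comp s).compDer (KaehlerDifferential.D k S)) f hf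

/-- A formally smooth algebra in characteristic `p` is a retract of the quotient of a noetherian
presentation by the `p`-th powers of the relations. -/
theorem Algebra.FormallySmooth.exists_section_quotient_map_frobenius {k R S : Type*} [CommRing k]
    [CommRing R] [CommRing S] [Algebra k R] [Algebra k S] [IsNoetherianRing R] (p : ℕ)
    [Fact p.Prime] [CharP R p] [Algebra.FormallySmooth k S] (φ : R →ₐ[k] S)
    (hφ : Function.Surjective φ) :
    ∃ σ : S →ₐ[k] R ⧸ (RingHom.ker φ).map (frobenius R p),
      ∀ s r, Ideal.Quotient.mk _ r = σ s → φ r = s := by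
  have hle : (RingHom.ker φ).map (frobenius R p) ≤ RingHom.ker φ := by
    refine Ideal.map_le_iff_le_comap.2 fun x hx ↦ ?_
    rw [Ideal.mem_comap, frobenius_def]
    exact Ideal.pow_mem_of_mem _ hx _ (Fact.out : p.Prime).pos
  let ψ : (R ⧸ (RingHom.ker φ).map (frobenius R p)) →ₐ[k] S := Ideal.Quotient.liftₐ _ φ hle
  have hψ (r : R) : ψ (Ideal.Quotient.mk _ r) = φ r := rfl
  have hnil : IsNilpotent (RingHom.ker ψ) := by
    rw [Ideal.FG.isNilpotent_iff_le_nilradical (IsNoetherian.noetherian _)]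
    intro x hx
    obtain ⟨r, rfl⟩ := Ideal.Quotient.mk_surjective x
    refine ⟨p, ?_⟩
    rw [← map_pow, Submodule.zero_eq_bot, Ideal.mem_bot, Ideal.Quotient.eq_zero_iff_mem,
      ← frobenius_def]
    exact Ideal.mem_map_of_mem _ hx
  have hψ' : Function.Surjective ψ := fun s ↦ (hφ s).imp' _ fun r hr ↦ (hψ r).trans hr
  refine ⟨Algebra.FormallySmooth.liftOfSurjective (AlgHom.id k S) ψ hψ' hnil, fun s r h ↦ ?_⟩
  rw [← hψ, h]
  exact Algebra.FormallySmooth.liftOfSurjective_apply (AlgHom.id k S) ψ hψ' hnil s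

theorem Algebra.FormallySmooth.mem_of_pow_mem_map_frobenius {k R S : Type*} [CommRing k]
    [CommRing R] [CommRing S] [Algebra k R] [Algebra k S] [IsNoetherianRing R] (p : ℕ)
    [Fact p.Prime] [CharP R p] [CharP S p] [Algebra.FormallySmooth k S] (φ : R →ₐ[k] S)
    (hφ : Function.Surjective φ)
    (hR : ∀ (J : Ideal R) (a : R), a ^ p ∈ J.map (frobenius R p) → a ∈ J)
    (J : Ideal S) (a : S) (ha : a ^ p ∈ J.map (frobenius S p)) : a ∈ J := by
  obtain ⟨σ, hσ⟩ := exists_section_quotient_map_frobenius p φ hφ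
  have h : J.map (frobenius S p) ≤
      (((J.comap φ).map (frobenius R p)).map (Ideal.Quotient.mk _)).comap σ := by
    refine Ideal.map_le_iff_le_comap.2 fun j hj ↦ ?_
    obtain ⟨r, hr⟩ := Ideal.Quotient.mk_surjective (σ j)
    rw [Ideal.mem_comap, Ideal.mem_comap, frobenius_def, map_pow, ← hr, ← map_pow, ← frobenius_def]
    refine Ideal.mem_map_of_mem _ (Ideal.mem_map_of_mem _ ?_)
    rwa [Ideal.mem_comap, hσ _ _ hr]
  obtain ⟨r, hr⟩ := Ideal.Quotient.mk_surjective (σ a)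
  have h' := h ha
  rw [Ideal.mem_comap, map_pow, ← hr, ← map_pow, Ideal.mem_quotient_iff_mem
    (Ideal.map_mono (Ideal.ker_le_comap φ))] at h'
  have := hR _ _ h'
  rwa [Ideal.mem_comap, hσ _ _ hr] at this

open MvPolynomial in
theorem Algebra.FormallySmooth.le_span_of_derivation_mem {k R S ι : Type*} [Field k]
    [CommRing R] [CommRing S] [Algebra k R] [Algebra k S] [IsNoetherianRing R] (p : ℕ)
    [Fact p.Prime] [CharP k p] [PerfectRing k p] [CharP R p] [Algebra.FormallySmooth k S]
    [Fintype ι] [Algebra (MvPolynomial ι k) R] [IsScalarTower k (MvPolynomial ι k) R]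
    (M : Submonoid (MvPolynomial ι k)) [IsLocalization M R] (φ : R →ₐ[k] S)
    (hφ : Function.Surjective φ) (I : Ideal S) (hI : ∀ D : Derivation k S S, ∀ f ∈ I, D f ∈ I) :
    I ≤ Ideal.span {f | f ∈ I ∧ ∃ g, f = g ^ p} := by
  obtain ⟨σ, hσ⟩ := exists_section_quotient_map_frobenius p φ hφ
  let K : Ideal R := (RingHom.ker φ).map (frobenius R p)
  let I' : Ideal (R ⧸ K) := I.map σ
  let L : Ideal (MvPolynomial ι k) :=
    I'.comap ((Ideal.Quotient.mk K).comp (algebraMap (MvPolynomial ι k) R))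
  have hstab (D : Derivation k R R) (r : R) (hr : Ideal.Quotient.mk K r ∈ I') :
      Ideal.Quotient.mk K (D r) ∈ I' := by
    have hmk : Function.Surjective (Ideal.Quotient.mkₐ k K) := Ideal.Quotient.mk_surjective
    let D' : Derivation k (R ⧸ K) (R ⧸ K) := Derivation.liftOfSurjective hmk (d := D) (by
      intro x hx
      exact Ideal.Quotient.eq_zero_iff_mem.2
        (D.iterate_mem_map_frobenius p _ 1 (Ideal.Quotient.eq_zero_iff_mem.1 hx)))
    have hD' (r : R) : D' (Ideal.Quotient.mk K r) = Ideal.Quotient.mk K (D r) :=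
      Derivation.liftOfSurjective_apply hmk _ r
    rw [← hD']
    generalize Ideal.Quotient.mk K r = x at hr
    induction hr using Submodule.span_induction with
    | mem x hx =>
      obtain ⟨f, hf, rfl⟩ := hx
      let _ : Algebra S (R ⧸ K) := σ.toRingHom.toAlgebra
      have : IsScalarTower k S (R ⧸ K) := .of_algebraMap_eq fun x ↦ (σ.commutes x).symm
      exact Derivation.apply_mem_map_of_forall_apply_mem hI (D'.compAlgebraMap S) hf
    | zero => rw [map_zero]; exact zero_mem _
    | add x y _ _ hx hy => rw [map_add]; exact add_mem hx hy
    | smul a x hx hx' =>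
      rw [smul_eq_mul, D'.leibniz]
      exact add_mem (Ideal.mul_mem_left _ _ hx') (Ideal.mul_mem_right _ _ hx)
  have hL : ∀ i, ∀ f ∈ L, pderiv i f ∈ L := by
    intro i f hf
    obtain ⟨D, hD⟩ := Derivation.exists_extend_isLocalization M R (pderiv (R := k) i)
    have := hstab D _ hf
    rwa [hD] at this
  have hLI : ∀ f ∈ L, φ (algebraMap _ R f) ∈ I := by
    intro f hf
    have hle : K ≤ I.comap φ := by
      refine Ideal.map_le_iff_le_comap.2 fun x hx ↦ ?_
      rw [Ideal.mem_comap, Ideal.mem_comap, frobenius_def, map_pow, (RingHom.mem_ker).1 hx,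
        zero_pow (Fact.out : p.Prime).ne_zero]
      exact zero_mem _
    refine (Ideal.mem_quotient_iff_mem hle).1 ((Ideal.map_le_iff_le_comap.2 ?_ : I' ≤ _) hf)
    intro x hx
    obtain ⟨r, hr⟩ := Ideal.Quotient.mk_surjective (σ x)
    rw [Ideal.mem_comap, ← hr]
    refine Ideal.mem_map_of_mem _ ?_
    rwa [Ideal.mem_comap, hσ _ _ hr]
  intro f hf
  obtain ⟨r, hr⟩ := Ideal.Quotient.mk_surjective (σ f)
  obtain ⟨x, s, rfl⟩ := IsLocalization.exists_mk'_eq M r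
  have hx : x ∈ L := by
    rw [Ideal.mem_comap, RingHom.comp_apply, ← IsLocalization.mk'_spec R x s, map_mul]
    refine Ideal.mul_mem_right _ _ ?_
    have h := Ideal.mem_map_of_mem σ hf
    rwa [← hr] at h
  have h := Ideal.mem_map_of_mem ((φ : R →+* S).comp (algebraMap _ R))
    (le_span_of_pderiv_mem p L hL hx)
  rw [Ideal.map_span, RingHom.comp_apply, ← IsLocalization.mk'_spec R x s, map_mul] at h
  have hu : IsUnit ((φ : R →+* S) (algebraMap _ R (s : MvPolynomial ι k))) :=
    (IsLocalization.map_units R s).map _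
  rw [Ideal.mul_unit_mem_iff_mem _ hu, RingHom.coe_coe, hσ _ _ hr] at h
  refine Ideal.span_mono ?_ h
  rintro _ ⟨y, ⟨hy, g, rfl⟩, rfl⟩
  exact ⟨hLI _ hy, φ (algebraMap _ R g), by simp⟩

end FormallySmooth

section EssFiniteType

open MvPolynomial

/-- An algebra essentially of finite type is a quotient of a localized polynomial ring. -/
theorem Algebra.EssFiniteType.exists_surjective_localization (k S : Type*) [CommRing k]
    [CommRing S] [Algebra k S] [Algebra.EssFiniteType k S] :
    ∃ (s : Finset S) (M : Submonoid (MvPolynomial s k)) (φ : Localization M →ₐ[k] S),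
      Function.Surjective φ := by
  obtain ⟨s, hs⟩ := (Algebra.essFiniteType_iff k S).1 inferInstance
  let f : MvPolynomial s k →ₐ[k] S := aeval (↑)
  let M : Submonoid (MvPolynomial s k) := (IsUnit.submonoid S).comap f
  have hM : ∀ y : M, IsUnit (f y) := fun y ↦ y.2
  refine ⟨s, M, IsLocalization.liftAlgHom (S := Localization M) hM, fun x ↦ ?_⟩
  obtain ⟨t, ht, hu, hxt⟩ := hs x
  have hf : f.range = Algebra.adjoin k (s : Set S) := by
    rw [← Algebra.adjoin_range_eq_range_aeval, Subtype.range_coe_subtype]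
    rfl
  rw [← hf] at ht hxt
  obtain ⟨b, rfl⟩ := ht
  obtain ⟨a, ha⟩ := hxt
  refine ⟨IsLocalization.mk' _ a (⟨b, hu⟩ : M), ?_⟩
  rw [IsLocalization.liftAlgHom_apply, IsLocalization.lift_mk'_spec]
  exact ha.trans (mul_comm _ _)

end EssFiniteType

theorem TruncatedWittVector.exists_ringHom_eq_coeff_zero (p n : ℕ) [Fact p.Prime] (hn : 0 < n)
    (S : Type*) [CommRing S] :
    ∃ f : TruncatedWittVector p n S →+* S, ∀ w, f w = coeff ⟨0, hn⟩ w := by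
  have h (x : WittVector p S) :
      coeff ⟨0, hn⟩ (WittVector.truncate n x) = WittVector.constantCoeff x := by
    rw [WittVector.coeff_truncate, WittVector.constantCoeff_apply]
  have hs := WittVector.truncate_surjective p n S
  refine ⟨⟨⟨⟨fun w ↦ coeff ⟨0, hn⟩ w, ?_⟩, fun x y ↦ ?_⟩, ?_, fun x y ↦ ?_⟩, fun _ ↦ rfl⟩
  · simpa using h 1
  · obtain ⟨x, rfl⟩ := hs x
    obtain ⟨y, rfl⟩ := hs y
    simp only [← map_mul, h]
  · simp
  · obtain ⟨x, rfl⟩ := hs x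
    obtain ⟨y, rfl⟩ := hs y
    simp only [← map_add, h]

/-- Let `k` be a perfect field of characteristic `p > 2` and `S` a commutative
`k`-algebra, essentially of finite type and formally smooth over `k`. Let `m` be an ideal of
`W_n(S)` (`n ≥ 1`) and `m̄ ⊆ S` the image of `m` under the first Witt coefficient map. If for
every `z = (z_1, …, z_n) ∈ m` one has `Σ_{i=1}^n z_i^{p^{n−i}−1}·d z_i ∈ m̄^{[p^{n−1}]}·Ω¹_{S/k}`,
then `m̄ = (m̄ ∩ Sᵖ)·S`. -/
theorem stmt_4 (p : ℕ) [Fact p.Prime] (hp : 2 < p)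
    (k : Type u) [Field k] [CharP k p] [ExpChar k p] [PerfectRing k p]
    (S : Type u) [CommRing S] [Algebra k S]
    [Algebra.EssFiniteType k S] [Algebra.FormallySmooth k S]
    (n : ℕ) (hn : 0 < n)
    (m : Ideal (TruncatedWittVector p n S))
    (hd : ∀ z ∈ m,
      (∑ j : Fin n, (TruncatedWittVector.coeff j z ^ (p ^ (n - 1 - (j : ℕ)) - 1)) •
          KaehlerDifferential.D k S (TruncatedWittVector.coeff j z)) ∈
        (Ideal.span ((fun s : S => s ^ p ^ (n - 1)) ''
            ((fun w : TruncatedWittVector p n S => TruncatedWittVector.coeff ⟨0, hn⟩ w) ''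
              (m : Set (TruncatedWittVector p n S))))) •
          (⊤ : Submodule S (KaehlerDifferential k S))) :
    (fun w : TruncatedWittVector p n S => TruncatedWittVector.coeff ⟨0, hn⟩ w) ''
        (m : Set (TruncatedWittVector p n S)) =
      ↑(Ideal.span ((fun w : TruncatedWittVector p n S => TruncatedWittVector.coeff ⟨0, hn⟩ w) ''
          (m : Set (TruncatedWittVector p n S)) ∩ {s : S | ∃ t : S, s = t ^ p})) := by
  let coeff₀ := fun w : TruncatedWittVector p n S => TruncatedWittVector.coeff ⟨0, hn⟩ w
  obtain ⟨c, hc⟩ := TruncatedWittVector.exists_ringHom_eq_coeff_zero p n hn S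
  have hsurj : Function.Surjective c := by
    intro s
    exact ⟨TruncatedWittVector.mk p fun _ ↦ s, by rw [hc, TruncatedWittVector.coeff_mk]⟩
  obtain ⟨I, hI⟩ : ∃ I : Ideal S, coeff₀ '' (m : Set (TruncatedWittVector p n S)) = I := by
    refine ⟨m.map c, Set.ext fun s ↦ ?_⟩
    simp only [coeff₀, SetLike.mem_coe, Ideal.mem_map_iff_of_surjective c hsurj, hc, Set.mem_image]
  change coeff₀ '' m = Ideal.span (coeff₀ '' m ∩ _)
  change ∀ z ∈ m, _ ∈ Ideal.span (_ '' (coeff₀ '' m)) • _ at hd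
  rw [hI] at hd ⊢
  refine SetLike.coe_set_eq.2 (le_antisymm ?_ (Ideal.span_le.2 fun _ h ↦ h.1))
  cases subsingleton_or_nontrivial S with
  | inl _ =>
    intro x _
    rw [Subsingleton.elim x 0]
    exact zero_mem _
  | inr _ =>
    have : CharP S p := charP_of_injective_algebraMap' k p
    obtain ⟨s, M, φ, hφ⟩ := Algebra.EssFiniteType.exists_surjective_localization k S
    have : Nontrivial (Localization M) := φ.toRingHom.domain_nontrivial
    have : CharP (Localization M) p := charP_of_injective_algebraMap' k p
    have : IsNoetherianRing (Localization M) := IsLocalization.isNoetherianRing M _ inferInstance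
    have hS := Algebra.FormallySmooth.mem_of_pow_mem_map_frobenius p φ hφ
      (IsLocalization.mem_of_pow_mem_map_frobenius p M _
        (MvPolynomial.mem_of_pow_mem_map_frobenius p))
    refine Algebra.FormallySmooth.le_span_of_derivation_mem p M φ hφ I fun D f hf ↦ ?_
    obtain ⟨z, hz, rfl⟩ : f ∈ coeff₀ '' m := hI ▸ hf
    obtain ⟨n, rfl⟩ := Nat.exists_eq_add_one.2 hn
    let z' (j : ℕ) : S := if h : j < n + 1 then TruncatedWittVector.coeff ⟨j, h⟩ z else 0
    have := Derivation.apply_mem_of_sum_mem_map_iterateFrobenius p hS I z' n (fun D ↦ ?_) D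
    · simpa [z', coeff₀] using this
    · rw [← Fin.sum_univ_eq_sum_range (fun j ↦ z' j ^ (p ^ (n - j) - 1) * D (z' j))]
      have h := Submodule.mem_map_of_mem (f := D.liftKaehlerDifferential) (hd z hz)
      rw [Submodule.map_smul'', map_sum, smul_eq_mul] at h
      have hz' (j : Fin (n + 1)) : z' j = TruncatedWittVector.coeff j z := dif_pos j.2
      change _ ∈ Ideal.span ((fun s ↦ s ^ p ^ n) '' (I : Set S))
      simpa [hz'] using Ideal.mul_le_left h
end
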